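/- Off-diagonal extrapolation with sharp constants: Let 1 ≤ p₀ ≤ q₀ < ∞ and γ > 0, and let T be an operator mapping measurable functions on ℝⁿ to measurable functions on ℝⁿ (not assumed linear). Suppose there is a constant c₀ such that for every weight w ∈ A_{p₀,q₀} and every measurable f, ‖w·Tf‖_{L^{q₀}(ℝⁿ)} ≤ c₀ [w]_{A_{p₀,q₀}}^γ ‖w·f‖_{L^{p₀}(ℝⁿ)}. Then for every pair of exponents p, q with 1 < p ≤ q < ∞ and 1/p − 1/q = 1/p₀ − 1/q₀ there is a constant c (depending only on n, p₀, q₀, p, q, γ, c₀) such that for every weight w ∈ A_{p,q} and every measurable f, ‖w·Tf‖_{L^{q}(ℝⁿ)} ≤ c [w]_{A_{p,q}}^{γ·max{1, (q₀/p₀′)·(p′/q)}} ‖w·f‖_{L^{p}(ℝⁿ)}. -/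

import Mathlib

open MeasureTheory ENNReal Set

noncomputable section

/-- Euclidean space `ℝⁿ`. -/
abbrev Euc (n : ℕ) := EuclideanSpace ℝ (Fin n)

variable {n : ℕ}

/-- The axis-parallel closed cube with lower corner `a` and side length `h`. -/
def Cube (a : Euc n) (h : ℝ) : Set (Euc n) :=
  {x | ∀ i, a i ≤ x i ∧ x i ≤ a i + h}

/-- The weighted measure `u(E) = ∫_E u dx` of a set. -/
def wMeas (u : Euc n → ℝ) (E : Set (Euc n)) : ℝ≥0∞ :=
  ∫⁻ x in E, ENNReal.ofReal (u x)

/-- The dual exponent `p' = p/(p-1)`. -/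
def dualExp (p : ℝ) : ℝ := p / (p - 1)

/-- The `A_{p,q}` constant of a weight `w` (with the `A_{1,q}` convention when `p = 1`). -/
def Apq (p q : ℝ) (w : Euc n → ℝ) : ℝ≥0∞ :=
  ⨆ (a : Euc n) (h : ℝ) (_ : 0 < h),
    ((volume (Cube a h))⁻¹ * ∫⁻ x in Cube a h, ENNReal.ofReal (w x) ^ q) *
      (if p = 1 then
        (essSup (fun x => (ENNReal.ofReal (w x))⁻¹) (volume.restrict (Cube a h))) ^ q
      else
        ((volume (Cube a h))⁻¹ * ∫⁻ x in Cube a h,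
            ENNReal.ofReal (w x) ^ (-(dualExp p))) ^ (q / dualExp p))

/-- The weighted Lebesgue norm `‖w f‖_{L^p(ℝⁿ)}`. -/
def wLp (w f : Euc n → ℝ) (p : ℝ) : ℝ≥0∞ :=
  (∫⁻ x, (ENNReal.ofReal (w x) * ENNReal.ofReal |f x|) ^ p) ^ (1 / p)

/-- The weighted Lebesgue norm `‖w g‖_{L^q(ℝⁿ)}` of an `ℝ≥0∞`-valued function. -/
def wLpE (w : Euc n → ℝ) (g : Euc n → ℝ≥0∞) (q : ℝ) : ℝ≥0∞ :=
  (∫⁻ x, (ENNReal.ofReal (w x) * g x) ^ q) ^ (1 / q)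

/-- The weak norm `‖g‖_{L^{q,∞}(u)} = sup_{λ>0} λ u({|g|>λ})^{1/q}`. -/
def weakLp (u : Euc n → ℝ) (g : Euc n → ℝ) (q : ℝ) : ℝ≥0∞ :=
  ⨆ (t : ℝ) (_ : 0 < t), ENNReal.ofReal t * wMeas u {x | t < |g x|} ^ (1 / q)

/-- The weak norm of an `ℝ≥0∞`-valued function. -/
def weakLpE (u : Euc n → ℝ) (g : Euc n → ℝ≥0∞) (q : ℝ) : ℝ≥0∞ :=
  ⨆ (t : ℝ) (_ : 0 < t), ENNReal.ofReal t * wMeas u {x | ENNReal.ofReal t < g x} ^ (1 / q)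

/-- The fractional integral (Riesz potential) `I_α f(x) = ∫ |f(y)| |x-y|^{α-n} dy`. -/
def riesz (α : ℝ) (f : Euc n → ℝ) (x : Euc n) : ℝ≥0∞ :=
  ∫⁻ y, ENNReal.ofReal |f y| * ENNReal.ofReal (‖x - y‖ ^ (α - (n : ℝ)))

/-- The fractional maximal operator `M_α f(x) = sup_{Q ∋ x} |Q|^{α/n-1} ∫_Q |f|`. -/
def fracMax (α : ℝ) (f : Euc n → ℝ) (x : Euc n) : ℝ≥0∞ :=
  ⨆ (a : Euc n) (h : ℝ) (_ : 0 < h) (_ : x ∈ Cube a h),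
    volume (Cube a h) ^ (α / (n : ℝ) - 1) * ∫⁻ y in Cube a h, ENNReal.ofReal |f y|


/-- Centered closed cube. -/
def cb (x : Euc n) (r : ℝ) : Set (Euc n) :=
  (fun y : Euc n => (WithLp.ofLp y : Fin n → ℝ)) ⁻¹' Metric.closedBall (WithLp.ofLp x) r

lemma continuous_ofLp_euc : Continuous (fun y : Euc n => (WithLp.ofLp y : Fin n → ℝ)) :=
  PiLp.continuous_ofLp 2 _

lemma isClosed_cb (x : Euc n) (r : ℝ) : IsClosed (cb x r) :=
  Metric.isClosed_closedBall.preimage continuous_ofLp_euc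

lemma measurableSet_cb (x : Euc n) (r : ℝ) : MeasurableSet (cb x r) :=
  (isClosed_cb x r).measurableSet

lemma mem_cb {x y : Euc n} {r : ℝ} :
    y ∈ cb x r ↔ dist (WithLp.ofLp y : Fin n → ℝ) (WithLp.ofLp x) ≤ r := Iff.rfl

lemma volume_cb (x : Euc n) {r : ℝ} (hr : 0 ≤ r) :
    volume (cb x r) = ENNReal.ofReal ((2 * r) ^ n) := by
  have := (PiLp.volume_preserving_ofLp (Fin n)).measure_preimage
    (Metric.isClosed_closedBall (x := (WithLp.ofLp x : Fin n → ℝ)) (ε := r)).measurableSet.nullMeasurableSet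
  rw [cb, this, Real.volume_pi_closedBall _ hr]; simp

lemma volume_cb_ne_zero (x : Euc n) {r : ℝ} (hr : 0 < r) : volume (cb x r) ≠ 0 := by
  rw [volume_cb x hr.le]; simp; positivity

lemma volume_cb_ne_top (x : Euc n) {r : ℝ} (hr : 0 ≤ r) : volume (cb x r) ≠ ⊤ := by
  rw [volume_cb x hr]; simp

lemma Cube_eq_cb (a : Euc n) {h : ℝ} (hh : 0 ≤ h) :
    Cube a h = cb (WithLp.toLp 2 (fun i => a i + h / 2)) (h / 2) := by
  ext x
  rw [mem_cb, dist_pi_le_iff (by positivity)]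
  simp only [Cube, mem_setOf_eq, Real.dist_eq, abs_le]
  refine forall_congr' fun i => ⟨fun h => ⟨?_, ?_⟩, fun h => ⟨?_, ?_⟩⟩ <;> linarith [h.1, h.2]

lemma cb_eq_Cube (x : Euc n) {r : ℝ} (hr : 0 ≤ r) :
    cb x r = Cube (WithLp.toLp 2 (fun i => x i - r)) (2 * r) := by
  rw [Cube_eq_cb _ (by positivity)]
  congr 1
  · ext i; simp
  · ring

/-- Centered maximal function with dyadic radii with respect to a measure. -/
def Mx (μ : Measure (Euc n)) (f : Euc n → ℝ≥0∞) (x : Euc n) : ℝ≥0∞ :=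
  ⨆ k : ℤ, (∫⁻ y in cb x ((2:ℝ) ^ k), f y ∂μ) / μ (cb x ((2:ℝ) ^ k))

lemma measurable_setLIntegral_cb (μ : Measure (Euc n)) [SFinite μ] {f : Euc n → ℝ≥0∞}
    (hf : Measurable f) (r : ℝ) : Measurable fun x => ∫⁻ y in cb x r, f y ∂μ := by
  have h1 : MeasurableSet {z : Euc n × Euc n | z.2 ∈ cb z.1 r} := by
    apply IsClosed.measurableSet
    have : {z : Euc n × Euc n | z.2 ∈ cb z.1 r} =
      {z | dist (WithLp.ofLp z.2 : Fin n → ℝ) (WithLp.ofLp z.1) ≤ r} := rfl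
    rw [this]
    exact isClosed_le ((continuous_ofLp_euc.comp continuous_snd).dist
      (continuous_ofLp_euc.comp continuous_fst)) continuous_const
  have h2 : Measurable ({z : Euc n × Euc n | z.2 ∈ cb z.1 r}.indicator (fun z => f z.2)) :=
    (hf.comp measurable_snd).indicator h1
  have := h2.lintegral_prod_right' (ν := μ)
  convert this using 2 with x
  rw [← lintegral_indicator (measurableSet_cb x r)]
  rfl

lemma measurable_Mx (μ : Measure (Euc n)) [SFinite μ] {f : Euc n → ℝ≥0∞}
    (hf : Measurable f) : Measurable (Mx μ f) := by
  refine Measurable.iSup fun k => (measurable_setLIntegral_cb μ hf _).div ?_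
  have := measurable_setLIntegral_cb μ (f := fun _ => 1) measurable_const ((2:ℝ)^k)
  simpa using this

theorem weak_type (n : ℕ) : ∃ N : ℕ, ∀ (μ : Measure (Euc n)) (f : Euc n → ℝ≥0∞) (t : ℝ≥0∞),
    t * μ {x | t < Mx μ f x} ≤ N * ∫⁻ x, f x ∂μ := by
  obtain ⟨N, τ, hτ, hN⟩ := HasBesicovitchCovering.no_satelliteConfig (α := Fin n → ℝ)
  refine ⟨N, fun μ f t => ?_⟩
  set S : ℕ → Set (Euc n) := fun K => {x | ∃ k : ℤ, k ≤ K ∧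
    t < (∫⁻ y in cb x ((2:ℝ) ^ k), f y ∂μ) / μ (cb x ((2:ℝ) ^ k))} with hS
  have hSm : Monotone S := by
    rintro a b hab x ⟨k, hk, h⟩
    exact ⟨k, hk.trans (by exact_mod_cast hab), h⟩
  have hSU : {x | t < Mx μ f x} = ⋃ K, S K := by
    ext x
    simp only [Mx, lt_iSup_iff, mem_setOf_eq, mem_iUnion, hS]
    constructor
    · rintro ⟨k, hk⟩
      exact ⟨k.toNat, k, Int.self_le_toNat k, hk⟩
    · rintro ⟨_, k, _, hk⟩
      exact ⟨k, hk⟩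
  rw [hSU, hSm.measure_iUnion, ENNReal.mul_iSup]
  refine iSup_le fun K => ?_
  choose! k hk hkt using fun (x : Euc n) (hx : x ∈ S K) => hx
  let q : Besicovitch.BallPackage (S K) (Fin n → ℝ) :=
    { c := fun b => WithLp.ofLp b.1
      r := fun b => (2:ℝ) ^ (k b.1)
      rpos := fun b => by positivity
      r_bound := (2:ℝ) ^ (K : ℤ)
      r_le := fun b => zpow_le_zpow_right₀ (by norm_num) (hk _ b.2) }
  obtain ⟨s, hs, hcov⟩ := Besicovitch.exist_disjoint_covering_families hτ hN q
  have hcount : ∀ i, (s i).Countable := fun i =>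
    (hs i).countable_of_nonempty_interior fun j _ => by
      refine ⟨q.c j, ?_⟩
      exact interior_maximal Metric.ball_subset_closedBall Metric.isOpen_ball
        (Metric.mem_ball_self (q.rpos j))
  have hsub : S K ⊆ ⋃ i : Fin N, ⋃ j ∈ s i, cb j.1 ((2:ℝ) ^ (k j.1)) := by
    intro x hx
    have := hcov ⟨⟨x, hx⟩, rfl⟩
    simp only [mem_iUnion] at this ⊢
    obtain ⟨i, j, hj, h⟩ := this
    exact ⟨i, j, hj, Metric.ball_subset_closedBall h⟩
  have hi : ∀ i, t * μ (⋃ j ∈ s i, cb j.1 ((2:ℝ) ^ (k j.1))) ≤ ∫⁻ x, f x ∂μ := by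
    intro i
    have hd : (s i).PairwiseDisjoint fun j => cb j.1 ((2:ℝ) ^ (k j.1)) := by
      intro a ha b hb hab
      exact (hs i ha hb hab).preimage _
    calc t * μ (⋃ j ∈ s i, cb j.1 ((2:ℝ) ^ (k j.1)))
        ≤ t * ∑' j : s i, μ (cb j.1.1 ((2:ℝ) ^ (k j.1.1))) := by
          gcongr; exact measure_biUnion_le μ (hcount i) _
      _ = ∑' j : s i, t * μ (cb j.1.1 ((2:ℝ) ^ (k j.1.1))) := ENNReal.tsum_mul_left.symm
      _ ≤ ∑' j : s i, ∫⁻ y in cb j.1.1 ((2:ℝ) ^ (k j.1.1)), f y ∂μ := by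
          refine ENNReal.tsum_le_tsum fun j => ?_
          exact ENNReal.mul_le_of_le_div (hkt _ j.1.2).le
      _ = ∫⁻ y in ⋃ j ∈ s i, cb j.1 ((2:ℝ) ^ (k j.1)), f y ∂μ :=
          (lintegral_biUnion (hcount i) (fun j _ => measurableSet_cb _ _) hd _).symm
      _ ≤ _ := setLIntegral_le_lintegral _ _
  calc t * μ (S K) ≤ t * ∑ i, μ (⋃ j ∈ s i, cb j.1 ((2:ℝ) ^ (k j.1))) := by
        gcongr
        refine (measure_mono hsub).trans ?_
        exact (measure_iUnion_le _).trans (by rw [tsum_fintype])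
    _ = ∑ i, t * μ (⋃ j ∈ s i, cb j.1 ((2:ℝ) ^ (k j.1))) := Finset.mul_sum _ _ _
    _ ≤ ∑ i : Fin N, ∫⁻ x, f x ∂μ := Finset.sum_le_sum fun i _ => hi i
    _ = _ := by simp

lemma two_zpow_rpow (k : ℤ) (s : ℝ) : ((2:ℝ≥0∞) ^ k) ^ s = 2 ^ ((k:ℝ) * s) := by
  rw [← ENNReal.rpow_intCast, ← ENNReal.rpow_mul]

lemma rpow_le_dyadic {p : ℝ} (hp : 0 < p) (y : ℝ≥0∞) :
    y ^ p ≤ ∑' k : ℤ, (if (2:ℝ≥0∞) * 2 ^ k < y then (2:ℝ≥0∞) ^ (((k:ℝ) + 2) * p) else 0) := by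
  rcases eq_or_ne y 0 with rfl | h0
  · simp [hp]
  rcases eq_or_ne y ⊤ with rfl | ht
  · have h1 : (⊤:ℝ≥0∞) = ∑' k : ℕ, (1:ℝ≥0∞) := by
      rw [ENNReal.tsum_const_eq_top_of_ne_zero one_ne_zero]
    rw [ENNReal.top_rpow_of_pos hp]
    refine le_trans h1.le (le_trans ?_ (ENNReal.tsum_comp_le_tsum_of_injective (Nat.cast_injective (R := ℤ)) _))
    refine ENNReal.tsum_le_tsum fun k => ?_
    have : (2:ℝ≥0∞) * 2 ^ (k:ℤ) < ⊤ := by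
      rw [zpow_natCast]; exact ENNReal.mul_lt_top (by simp) (by simp)
    rw [if_pos this]
    apply ENNReal.one_le_rpow (by norm_num); push_cast; positivity
  obtain ⟨m, hm1, hm2⟩ := ENNReal.exists_mem_Ioc_zpow h0 ht (y := 2) (by norm_num) (by simp)
  refine le_trans ?_ (ENNReal.le_tsum (m - 1))
  have : (2:ℝ≥0∞) * 2 ^ (m - 1) < y := by
    convert hm1 using 1
    have := ENNReal.zpow_add (x := 2) (by simp) (by simp) (m - 1) 1
    rw [zpow_one, mul_comm] at this
    rw [← this]; simp
  rw [if_pos this]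
  refine (ENNReal.rpow_le_rpow hm2 hp.le).trans (le_of_eq ?_)
  rw [two_zpow_rpow]; push_cast; congr 1; ring

lemma dyadic_geom {s : ℝ} (hs : 0 < s) (y : ℝ≥0∞) :
    ∑' k : ℤ, (if (2:ℝ≥0∞) ^ k < y then (2:ℝ≥0∞) ^ ((k:ℝ) * s) else 0) ≤
      (1 - (2:ℝ≥0∞) ^ (-s))⁻¹ * y ^ s := by
  rcases eq_or_ne y 0 with rfl | h0
  · simp
  rcases eq_or_ne y ⊤ with rfl | ht
  · rw [ENNReal.top_rpow_of_pos hs, ENNReal.mul_top]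
    · exact le_top
    · simp only [ne_eq, ENNReal.inv_eq_zero]
      exact ENNReal.sub_ne_top (by simp)
  obtain ⟨m, hm1, hm2⟩ := ENNReal.exists_mem_Ioc_zpow h0 ht (y := 2) (by norm_num) (by simp)
  have hinj : Function.Injective (fun j : ℕ => m - (j:ℤ)) := by
    intro a b h; simpa using h
  rw [← hinj.tsum_eq]
  · calc _ ≤ ∑' j : ℕ, (2:ℝ≥0∞) ^ ((m:ℝ) * s) * ((2:ℝ≥0∞) ^ (-s)) ^ j := by
          refine ENNReal.tsum_le_tsum fun j => ?_
          split_ifs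
          · rw [← ENNReal.rpow_natCast, ← ENNReal.rpow_mul, ← ENNReal.rpow_add _ _ (by simp) (by simp)]
            apply le_of_eq; congr 1; push_cast; ring
          · exact zero_le
      _ = (1 - (2:ℝ≥0∞) ^ (-s))⁻¹ * (2:ℝ≥0∞) ^ ((m:ℝ) * s) := by
          rw [ENNReal.tsum_mul_left, ENNReal.tsum_geometric, mul_comm]
      _ ≤ _ := by
          rw [← two_zpow_rpow]
          gcongr
  · intro k hk
    simp only [Function.mem_support, ne_eq, ite_eq_right_iff, Classical.not_imp] at hk
    have : k ≤ m := by
      by_contra! hlt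
      have h2 : (2:ℝ≥0∞) ^ (m + 1) ≤ 2 ^ k := ENNReal.zpow_le_of_le (by norm_num) (by omega)
      exact absurd hk.1 (not_lt.2 (hm2.trans h2))
    exact ⟨(m - k).toNat, by simp only; omega⟩

lemma Mx_le_add (μ : Measure (Euc n)) {f : Euc n → ℝ≥0∞} (hf : Measurable f) (t : ℝ≥0∞)
    (x : Euc n) : Mx μ f x ≤ Mx μ ({y | t < f y}.indicator f) x + t := by
  refine iSup_le fun k => ?_
  have hm : MeasurableSet {y | t < f y} := measurableSet_lt measurable_const hf
  have h1 : ∫⁻ y in cb x ((2:ℝ) ^ k), f y ∂μ ≤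
      (∫⁻ y in cb x ((2:ℝ) ^ k), {y | t < f y}.indicator f y ∂μ) + t * μ (cb x ((2:ℝ) ^ k)) := by
    rw [← setLIntegral_const, ← lintegral_add_right _ measurable_const]
    refine lintegral_mono fun y => ?_
    by_cases h : t < f y
    · simp [Set.indicator, h]
    · simp [Set.indicator, h, not_lt.1 h]
  calc _ ≤ ((∫⁻ y in cb x ((2:ℝ) ^ k), {y | t < f y}.indicator f y ∂μ)
          + t * μ (cb x ((2:ℝ) ^ k))) / μ (cb x ((2:ℝ) ^ k)) := by gcongr
    _ = _ := ENNReal.add_div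
    _ ≤ _ := by
      refine add_le_add (le_iSup (fun k : ℤ => (∫⁻ y in cb x ((2:ℝ) ^ k),
        {y | t < f y}.indicator f y ∂μ) / μ (cb x ((2:ℝ) ^ k))) k) ?_
      exact ENNReal.div_le_of_le_mul le_rfl

theorem strong_type (n : ℕ) (p : ℝ) (hp : 1 < p) : ∃ C : ℝ≥0∞, C ≠ ⊤ ∧
    ∀ (μ : Measure (Euc n)) [SFinite μ] (f : Euc n → ℝ≥0∞), Measurable f →
    ∫⁻ x, Mx μ f x ^ p ∂μ ≤ C * ∫⁻ x, f x ^ p ∂μ := by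
  obtain ⟨N, hN⟩ := weak_type n
  refine ⟨2 ^ (2 * p) * N * (1 - (2:ℝ≥0∞) ^ (-(p-1)))⁻¹, ?_, fun μ _ f hf => ?_⟩
  · refine ENNReal.mul_ne_top (ENNReal.mul_ne_top (by simp) (by simp)) ?_
    simp only [ne_eq, ENNReal.inv_eq_top, tsub_eq_zero_iff_le, not_le]
    exact ENNReal.rpow_lt_one_of_one_lt_of_neg (by norm_num) (by linarith)
  have hMm := measurable_Mx μ hf
  have hw : ∀ k : ℤ, (2:ℝ≥0∞) ^ k * μ {x | 2 * 2 ^ k < Mx μ f x} ≤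
      N * ∫⁻ x, {y | (2:ℝ≥0∞) ^ k < f y}.indicator f x ∂μ := by
    intro k
    refine le_trans ?_ (hN μ _ ((2:ℝ≥0∞) ^ k))
    refine mul_le_mul_right (measure_mono fun x hx => ?_) _
    have h1 := hx.trans_le (Mx_le_add μ hf ((2:ℝ≥0∞) ^ k) x)
    rw [two_mul] at h1
    exact lt_of_add_lt_add_right h1
  have hterm : ∀ k : ℤ, (2:ℝ≥0∞) ^ (((k:ℝ) + 2) * p) * μ {x | 2 * 2 ^ k < Mx μ f x} ≤
      2 ^ (2 * p) * N * ∫⁻ x, (2:ℝ≥0∞) ^ ((k:ℝ) * (p - 1)) *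
        {y | (2:ℝ≥0∞) ^ k < f y}.indicator f x ∂μ := by
    intro k
    have hm : Measurable ({y | (2:ℝ≥0∞) ^ k < f y}.indicator f) :=
      hf.indicator (measurableSet_lt measurable_const hf)
    rw [lintegral_const_mul _ hm]
    have e : (2:ℝ≥0∞) ^ (((k:ℝ) + 2) * p) = 2 ^ (2 * p) * 2 ^ ((k:ℝ) * (p - 1)) * 2 ^ k := by
      rw [← ENNReal.rpow_intCast, ← ENNReal.rpow_add _ _ (by simp) (by simp),
        ← ENNReal.rpow_add _ _ (by simp) (by simp)]
      congr 1; ring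
    calc _ = 2 ^ (2 * p) * 2 ^ ((k:ℝ) * (p - 1)) * (2 ^ k * μ {x | 2 * 2 ^ k < Mx μ f x}) := by
          rw [e]; ring
      _ ≤ 2 ^ (2 * p) * 2 ^ ((k:ℝ) * (p - 1)) *
          (N * ∫⁻ x, {y | (2:ℝ≥0∞) ^ k < f y}.indicator f x ∂μ) :=
          mul_le_mul_right (hw k) _
      _ = _ := by ring
  calc ∫⁻ x, Mx μ f x ^ p ∂μ
      ≤ ∫⁻ x, ∑' k : ℤ, (if (2:ℝ≥0∞) * 2 ^ k < Mx μ f x then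
          (2:ℝ≥0∞) ^ (((k:ℝ) + 2) * p) else 0) ∂μ :=
        lintegral_mono fun x => rpow_le_dyadic (by linarith) _
    _ = ∑' k : ℤ, (2:ℝ≥0∞) ^ (((k:ℝ) + 2) * p) * μ {x | 2 * 2 ^ k < Mx μ f x} := by
        rw [lintegral_tsum]
        · refine tsum_congr fun k => ?_
          rw [← lintegral_indicator_const (measurableSet_lt measurable_const hMm)]
          refine lintegral_congr fun x => ?_
          simp [Set.indicator]
        · intro k
          exact (Measurable.ite (measurableSet_lt measurable_const hMm) measurable_const
            measurable_const).aemeasurable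
    _ ≤ ∑' k : ℤ, 2 ^ (2 * p) * N * ∫⁻ x, (2:ℝ≥0∞) ^ ((k:ℝ) * (p - 1)) *
        {y | (2:ℝ≥0∞) ^ k < f y}.indicator f x ∂μ := ENNReal.tsum_le_tsum hterm
    _ = 2 ^ (2 * p) * N * ∫⁻ x, f x * ∑' k : ℤ, (if (2:ℝ≥0∞) ^ k < f x then
          (2:ℝ≥0∞) ^ ((k:ℝ) * (p - 1)) else 0) ∂μ := by
        rw [ENNReal.tsum_mul_left, ← lintegral_tsum]
        · congr 1
          refine lintegral_congr fun x => ?_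
          rw [← ENNReal.tsum_mul_left]
          refine tsum_congr fun k => ?_
          simp only [Set.indicator, mem_ofPred_eq]
          split_ifs <;> simp [mul_comm]
        · intro k
          exact ((hf.indicator (measurableSet_lt measurable_const hf)).const_mul _).aemeasurable
    _ ≤ 2 ^ (2 * p) * N * ∫⁻ x, (1 - (2:ℝ≥0∞) ^ (-(p-1)))⁻¹ * f x ^ p ∂μ := by
        refine mul_le_mul_right (lintegral_mono fun x => ?_) _
        calc f x * _ ≤ f x * ((1 - (2:ℝ≥0∞) ^ (-(p-1)))⁻¹ * f x ^ (p - 1)) := by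
              exact mul_le_mul_right (dyadic_geom (by linarith) _) _
          _ = (1 - (2:ℝ≥0∞) ^ (-(p-1)))⁻¹ * (f x ^ (1:ℝ) * f x ^ (p - 1)) := by
              rw [ENNReal.rpow_one]; ring
          _ = _ := by
              rw [← ENNReal.rpow_add_of_nonneg _ _ (by norm_num) (by linarith)]; congr 2; ring
    _ = _ := by rw [lintegral_const_mul _ (hf.pow_const p)]; ring

lemma setLIntegral_cb_ne_zero {w : Euc n → ℝ≥0∞} (hw : Measurable w) (h0 : ∀ x, w x ≠ 0)
    (x : Euc n) {r : ℝ} (hr : 0 < r) : ∫⁻ y in cb x r, w y ≠ 0 := by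
  intro h
  rw [lintegral_eq_zero_iff hw] at h
  have h2 : volume.restrict (cb x r) = 0 := by
    rw [← ae_eq_bot, ← Filter.eventually_false_iff_eq_bot]
    filter_upwards [h] with y hy using h0 y hy
  rw [Measure.restrict_eq_zero] at h2
  exact volume_cb_ne_zero x hr h2

lemma cb_subset {x y : Euc n} {r s : ℝ}
    (h : dist (WithLp.ofLp x : Fin n → ℝ) (WithLp.ofLp y) + r ≤ s) : cb x r ⊆ cb y s := by
  intro z hz
  rw [mem_cb] at hz ⊢
  linarith [dist_triangle (WithLp.ofLp z : Fin n → ℝ) (WithLp.ofLp x) (WithLp.ofLp y)]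

lemma volume_cb_four (x : Euc n) {r : ℝ} (hr : 0 ≤ r) :
    volume (cb x (4 * r)) = 4 ^ n * volume (cb x r) := by
  rw [volume_cb x hr, volume_cb x (by positivity), show 2 * (4 * r) = 4 * (2 * r) by ring, mul_pow,
    ENNReal.ofReal_mul (by positivity), ENNReal.ofReal_pow (by norm_num)]
  simp

lemma buckley_pointwise {p : ℝ} (hp : 1 < p) {w : Euc n → ℝ≥0∞} (hw : Measurable w)
    (h0 : ∀ x, w x ≠ 0) (ht : ∀ x, w x ≠ ⊤) {K : ℝ≥0∞} (hK : K ≠ ⊤)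
    (hA : ∀ x r, 0 < r → (∫⁻ y in cb x r, w y) * (∫⁻ y in cb x r, w y ^ (-1 / (p - 1))) ^ (p - 1)
      ≤ K * volume (cb x r) ^ p) {f : Euc n → ℝ≥0∞} (hf : Measurable f) (x : Euc n) :
    Mx volume f x ^ (p - 1) ≤ (4 ^ n) ^ p * K * Mx (volume.withDensity w)
      (fun y => Mx (volume.withDensity fun y => w y ^ (-1 / (p - 1)))
        (fun z => f z * (w z ^ (-1 / (p - 1)))⁻¹) y ^ (p - 1) * (w y)⁻¹) x := by
  have hp1 : 0 < p - 1 := by linarith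
  set σ : Euc n → ℝ≥0∞ := fun y => w y ^ (-1 / (p - 1)) with hσ
  have hσm : Measurable σ := hw.pow_const _
  have hσ0 : ∀ x, σ x ≠ 0 := fun x => by simp [hσ, ENNReal.rpow_eq_zero_iff, h0, ht]
  have hσt : ∀ x, σ x ≠ ⊤ := fun x => by simp [hσ, ENNReal.rpow_eq_top_iff, h0, ht]
  set φ : Euc n → ℝ≥0∞ := Mx (volume.withDensity σ) (fun z => f z * (σ z)⁻¹) with hφ
  have hφm : Measurable φ := measurable_Mx _ (hf.fun_mul hσm.fun_inv)
  have key : ∀ k : ℤ, ((∫⁻ y in cb x ((2:ℝ) ^ k), f y) / volume (cb x ((2:ℝ) ^ k))) ^ (p - 1) ≤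
      (4 ^ n) ^ p * K * Mx (volume.withDensity w) (fun y => φ y ^ (p - 1) * (w y)⁻¹) x := by
    intro k
    have hr : (0:ℝ) < 2 ^ k := by positivity
    generalize hrr : (2:ℝ) ^ k = r at hr
    have hr2 : (2:ℝ) ^ (k + 1) = 2 * r := by rw [zpow_add_one₀ (by norm_num), hrr]; ring
    set a := ∫⁻ y in cb x r, f y
    set S := ∫⁻ y in cb x (4 * r), σ y with hS
    set ω := ∫⁻ y in cb x r, w y with hω
    set V := volume (cb x r)
    set m := Mx (volume.withDensity w) (fun y => φ y ^ (p - 1) * (w y)⁻¹) x with hm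
    have hV0 : V ≠ 0 := volume_cb_ne_zero x hr
    have hVt : V ≠ ⊤ := volume_cb_ne_top x hr.le
    have hS0 : S ≠ 0 := setLIntegral_cb_ne_zero hσm hσ0 x (by positivity)
    have hω0 : ω ≠ 0 := setLIntegral_cb_ne_zero hw h0 x hr
    have hAx := hA x (4 * r) (by positivity)
    have hsub4 : cb x r ⊆ cb x (4 * r) := cb_subset (by simp; linarith)
    have hωS : ω * S ^ (p - 1) ≤ (4 ^ n) ^ p * K * (V * V ^ (p - 1)) := by
      calc ω * S ^ (p - 1) ≤ (∫⁻ y in cb x (4 * r), w y) * S ^ (p - 1) := by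
            exact mul_le_mul_left (lintegral_mono_set hsub4) _
        _ ≤ _ := hAx
        _ = _ := by
          rw [volume_cb_four x hr.le, ENNReal.mul_rpow_of_nonneg _ _ (by linarith)]
          have : V ^ p = V * V ^ (p - 1) := by
            nth_rw 2 [← ENNReal.rpow_one V]
            rw [← ENNReal.rpow_add _ _ hV0 hVt]; congr 1; ring
          rw [← this]; ring
    have hRt : (4 ^ n) ^ p * K * (V * V ^ (p - 1)) ≠ ⊤ := by
      refine ENNReal.mul_ne_top (ENNReal.mul_ne_top ?_ hK) (ENNReal.mul_ne_top hVt ?_)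
      · exact ENNReal.rpow_ne_top_of_nonneg (by linarith) (by simp)
      · exact ENNReal.rpow_ne_top_of_nonneg (by linarith) hVt
    have hωSt : ω * S ^ (p - 1) ≠ ⊤ := ne_top_of_le_ne_top hRt hωS
    have hSt : S ≠ ⊤ := by
      intro h
      rw [h, ENNReal.top_rpow_of_pos hp1, ENNReal.mul_top hω0] at hωSt
      exact hωSt rfl
    have hωt : ω ≠ ⊤ := by
      intro h
      rw [h, ENNReal.top_mul] at hωSt
      · exact hωSt rfl
      · simp [ENNReal.rpow_eq_zero_iff, hS0, hSt]
    have hφy : ∀ y ∈ cb x r, a / S ≤ φ y := by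
      intro y hy
      have h1 : cb x r ⊆ cb y (2 * r) := cb_subset (by rw [dist_comm]; rw [mem_cb] at hy; linarith)
      have h2 : cb y (2 * r) ⊆ cb x (4 * r) := cb_subset (by rw [mem_cb] at hy; linarith)
      refine le_trans ?_ (le_iSup _ (k + 1))
      simp only [hr2]
      refine ENNReal.div_le_div ?_ ?_
      · rw [setLIntegral_withDensity_eq_setLIntegral_mul _ hσm (hf.fun_mul hσm.fun_inv) (measurableSet_cb _ _)]
        refine (lintegral_mono_set h1).trans (le_of_eq ?_)
        refine lintegral_congr fun z => ?_
        simp only [Pi.mul_apply]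
        rw [mul_comm (f z), ← mul_assoc, ENNReal.mul_inv_cancel (hσ0 z) (hσt z), one_mul]
      · rw [withDensity_apply _ (measurableSet_cb _ _)]
        exact lintegral_mono_set h2
    have hmain : (a / S) ^ (p - 1) * V ≤ ω * m := by
      have h1 : (a / S) ^ (p - 1) * V ≤ ∫⁻ y in cb x r, φ y ^ (p - 1) := by
        rw [← setLIntegral_const]
        exact setLIntegral_mono (hφm.pow_const _) fun y hy => ENNReal.rpow_le_rpow (hφy y hy) hp1.le
      have h2 : (∫⁻ y in cb x r, φ y ^ (p - 1)) / ω ≤ m := by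
        refine le_trans (le_of_eq ?_) (le_iSup _ k)
        simp only [hrr]
        rw [withDensity_apply _ (measurableSet_cb _ _),
          setLIntegral_withDensity_eq_setLIntegral_mul _ hw ((hφm.pow_const _).fun_mul hw.fun_inv)
            (measurableSet_cb _ _)]
        congr 1
        refine lintegral_congr fun z => ?_
        simp only [Pi.mul_apply]
        rw [mul_comm (φ z ^ _), ← mul_assoc, ENNReal.mul_inv_cancel (h0 z) (ht z), one_mul]
      rw [ENNReal.div_le_iff hω0 hωt, mul_comm] at h2
      exact h1.trans h2
    have haS : a = (a / S) * S := (ENNReal.div_mul_cancel hS0 hSt).symm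
    rw [ENNReal.div_rpow_of_nonneg _ _ hp1.le]
    have hVp0 : V ^ (p - 1) ≠ 0 := by simp [ENNReal.rpow_eq_zero_iff, hV0, hVt]
    have hVpt : V ^ (p - 1) ≠ ⊤ := ENNReal.rpow_ne_top_of_nonneg (by linarith) hVt
    rw [ENNReal.div_le_iff hVp0 hVpt, haS, ENNReal.mul_rpow_of_nonneg _ _ hp1.le]
    rw [← ENNReal.mul_le_mul_iff_left hV0 hVt]
    calc (a / S) ^ (p - 1) * S ^ (p - 1) * V = ((a / S) ^ (p - 1) * V) * S ^ (p - 1) := by ring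
      _ ≤ ω * m * S ^ (p - 1) := by gcongr
      _ = ω * S ^ (p - 1) * m := by ring
      _ ≤ (4 ^ n) ^ p * K * (V * V ^ (p - 1)) * m := by gcongr
      _ = _ := by ring
  rw [← ENNReal.le_rpow_inv_iff hp1]
  refine iSup_le fun k => ?_
  rw [ENNReal.le_rpow_inv_iff hp1]
  exact key k

theorem buckley (n : ℕ) (p : ℝ) (hp : 1 < p) : ∃ C : ℝ≥0∞, C ≠ ⊤ ∧
    ∀ (w : Euc n → ℝ≥0∞), Measurable w → (∀ x, w x ≠ 0) → (∀ x, w x ≠ ⊤) →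
    ∀ K : ℝ≥0∞, K ≠ ⊤ →
    (∀ x r, 0 < r → (∫⁻ y in cb x r, w y) * (∫⁻ y in cb x r, w y ^ (-1 / (p - 1))) ^ (p - 1)
      ≤ K * volume (cb x r) ^ p) →
    ∀ f : Euc n → ℝ≥0∞, Measurable f →
    ∫⁻ x, Mx volume f x ^ p * w x ≤ C * K ^ (p / (p - 1)) * ∫⁻ x, f x ^ p * w x := by
  have hp1 : 0 < p - 1 := by linarith
  have hp' : 1 < p / (p - 1) := by rw [lt_div_iff₀ hp1]; linarith
  obtain ⟨C1, hC1, hs1⟩ := strong_type n p hp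
  obtain ⟨C2, hC2, hs2⟩ := strong_type n (p / (p - 1)) hp'
  refine ⟨((4 ^ n) ^ p) ^ (p / (p - 1)) * C2 * C1, ?_, ?_⟩
  · refine ENNReal.mul_ne_top (ENNReal.mul_ne_top ?_ hC2) hC1
    exact ENNReal.rpow_ne_top_of_nonneg (by linarith)
      (ENNReal.rpow_ne_top_of_nonneg (by linarith) (by simp))
  intro w hw h0 ht K hK hA f hf
  have hpt := buckley_pointwise hp hw h0 ht hK hA hf
  set σ : Euc n → ℝ≥0∞ := fun y => w y ^ (-1 / (p - 1)) with hσ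
  have hσm : Measurable σ := hw.pow_const _
  have hσ0 : ∀ x, σ x ≠ 0 := fun x => by simp [hσ, ENNReal.rpow_eq_zero_iff, h0, ht]
  have hσt : ∀ x, σ x ≠ ⊤ := fun x => by simp [hσ, ENNReal.rpow_eq_top_iff, h0, ht]
  set φ : Euc n → ℝ≥0∞ := Mx (volume.withDensity σ) (fun z => f z * (σ z)⁻¹) with hφ
  have hφm : Measurable φ := measurable_Mx _ (hf.fun_mul hσm.fun_inv)
  set ψ : Euc n → ℝ≥0∞ := fun y => φ y ^ (p - 1) * (w y)⁻¹ with hψ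
  have hψm : Measurable ψ := (hφm.pow_const _).fun_mul hw.fun_inv
  have hMψ : Measurable (Mx (volume.withDensity w) ψ) := measurable_Mx _ hψm
  have e1 : (p - 1) * (p / (p - 1)) = p := by field_simp
  set L := (4 ^ n) ^ p * K with hL
  calc ∫⁻ x, Mx volume f x ^ p * w x
      ≤ ∫⁻ x, L ^ (p / (p - 1)) * (w x * Mx (volume.withDensity w) ψ x ^ (p / (p - 1))) := by
        refine lintegral_mono fun x => ?_
        have := ENNReal.rpow_le_rpow (hpt x) (z := p / (p - 1)) (by linarith)
        rw [← ENNReal.rpow_mul, e1, ENNReal.mul_rpow_of_nonneg _ _ (by linarith)] at this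
        calc _ ≤ L ^ (p / (p - 1)) * Mx (volume.withDensity w) ψ x ^ (p / (p - 1)) * w x := by
              gcongr
          _ = _ := by ring
    _ = L ^ (p / (p - 1)) * ∫⁻ x, Mx (volume.withDensity w) ψ x ^ (p / (p - 1))
          ∂(volume.withDensity w) := by
        rw [lintegral_const_mul _ (hw.fun_mul (hMψ.pow_const _)),
          lintegral_withDensity_eq_lintegral_mul _ hw (hMψ.pow_const _)]
        rfl
    _ ≤ L ^ (p / (p - 1)) * (C2 * ∫⁻ x, ψ x ^ (p / (p - 1)) ∂(volume.withDensity w)) :=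
        mul_le_mul_right (hs2 _ _ hψm) _
    _ = L ^ (p / (p - 1)) * (C2 * ∫⁻ x, φ x ^ p ∂(volume.withDensity σ)) := by
        rw [lintegral_withDensity_eq_lintegral_mul _ hw (hψm.pow_const _),
          lintegral_withDensity_eq_lintegral_mul _ hσm (hφm.pow_const _)]
        congr 2
        refine lintegral_congr fun x => ?_
        simp only [Pi.mul_apply, hψ, hσ]
        rw [ENNReal.mul_rpow_of_nonneg _ _ (by linarith), ← ENNReal.rpow_mul, e1,
          mul_comm, mul_assoc, mul_comm]
        congr 1
        rw [ENNReal.inv_rpow, ← ENNReal.rpow_neg]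
        nth_rw 2 [← ENNReal.rpow_one (w x)]
        rw [← ENNReal.rpow_add _ _ (h0 x) (ht x)]
        congr 1; field_simp; ring
    _ ≤ L ^ (p / (p - 1)) * (C2 * (C1 * ∫⁻ x, (f x * (σ x)⁻¹) ^ p ∂(volume.withDensity σ))) :=
        mul_le_mul_right (mul_le_mul_right (hs1 _ _ (hf.fun_mul hσm.fun_inv)) _) _
    _ = L ^ (p / (p - 1)) * (C2 * (C1 * ∫⁻ x, f x ^ p * w x)) := by
        rw [lintegral_withDensity_eq_lintegral_mul _ hσm ((hf.fun_mul hσm.fun_inv).pow_const _)]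
        congr 3
        refine lintegral_congr fun x => ?_
        simp only [Pi.mul_apply, hσ]
        rw [ENNReal.mul_rpow_of_nonneg _ _ (by linarith), mul_comm, mul_assoc]
        congr 1
        rw [ENNReal.inv_rpow, ← ENNReal.rpow_neg, ← ENNReal.rpow_mul,
          ← ENNReal.rpow_add _ _ (h0 x) (ht x)]
        nth_rw 2 [← ENNReal.rpow_one (w x)]
        congr 1; field_simp; ring
    _ = _ := by
        rw [hL, ENNReal.mul_rpow_of_nonneg _ _ (by linarith)]; ring

lemma tsum_jensen {p : ℝ} (hp : 1 ≤ p) (a : ℕ → ℝ≥0∞) :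
    (∑' k, (2⁻¹:ℝ≥0∞) ^ k * a k) ^ p ≤ 2 ^ (p - 1) * ∑' k, (2⁻¹:ℝ≥0∞) ^ k * a k ^ p := by
  have hp0 : 0 < p := by linarith
  rw [← ENNReal.le_rpow_inv_iff hp0, ENNReal.tsum_eq_iSup_sum]
  refine iSup_le fun s => ?_
  refine (ENNReal.inner_le_weight_mul_Lp_of_nonneg s hp _ _).trans ?_
  rw [ENNReal.mul_rpow_of_nonneg _ _ (by positivity), ← ENNReal.rpow_mul]
  have e : (p - 1) * p⁻¹ = 1 - p⁻¹ := by field_simp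
  rw [e]
  have : 0 ≤ 1 - p⁻¹ := by rw [← e]; exact mul_nonneg (by linarith) (by positivity)
  refine mul_le_mul' (ENNReal.rpow_le_rpow ?_ this) (ENNReal.rpow_le_rpow ?_ (by positivity))
  · refine (ENNReal.sum_le_tsum s).trans (le_of_eq ?_)
    rw [ENNReal.tsum_geometric, ENNReal.one_sub_inv_two, inv_inv]
  · exact ENNReal.sum_le_tsum s

lemma Mx_tsum_le (μ : Measure (Euc n)) {f : ℕ → Euc n → ℝ≥0∞} (hf : ∀ k, Measurable (f k))
    (c : ℕ → ℝ≥0∞) (x : Euc n) :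
    Mx μ (fun y => ∑' k, c k * f k y) x ≤ ∑' k, c k * Mx μ (f k) x := by
  refine iSup_le fun m => ?_
  rw [lintegral_tsum (fun k => ((hf k).const_mul _).aemeasurable), div_eq_mul_inv,
    ← ENNReal.tsum_mul_right]
  refine ENNReal.tsum_le_tsum fun k => ?_
  rw [lintegral_const_mul _ (hf k), mul_assoc, ← div_eq_mul_inv]
  exact mul_le_mul_right (le_iSup (fun k' : ℤ => (∫⁻ y in cb x ((2:ℝ) ^ k'), f k y ∂μ) /
    μ (cb x ((2:ℝ) ^ k'))) m) _

lemma uncentered (f : Euc n → ℝ≥0∞) {z x : Euc n} {r : ℝ} (hr : 0 < r) (hx : x ∈ cb z r) :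
    ∫⁻ y in cb z r, f y ≤ 4 ^ n * volume (cb z r) * Mx volume f x := by
  obtain ⟨m, hm1, hm2⟩ := exists_mem_Ioc_zpow (x := 2 * r) (y := (2:ℝ)) (by positivity) (by norm_num)
  have h4 : (2:ℝ) ^ (m + 1) ≤ 4 * r := by rw [zpow_add_one₀ (by norm_num)]; linarith
  rw [mem_cb] at hx
  have h1 : cb z r ⊆ cb x ((2:ℝ) ^ (m + 1)) := cb_subset (by rw [dist_comm]; linarith)
  have h2 : cb x ((2:ℝ) ^ (m + 1)) ⊆ cb x (4 * r) := cb_subset (by simpa using h4)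
  have hv : volume (cb x ((2:ℝ) ^ (m + 1))) ≤ 4 ^ n * volume (cb z r) := by
    refine (measure_mono h2).trans (le_of_eq ?_)
    rw [volume_cb_four x hr.le, volume_cb _ hr.le, volume_cb _ hr.le]
  calc _ ≤ ∫⁻ y in cb x ((2:ℝ) ^ (m + 1)), f y := lintegral_mono_set h1
    _ = volume (cb x ((2:ℝ) ^ (m + 1))) *
        ((∫⁻ y in cb x ((2:ℝ) ^ (m + 1)), f y) / volume (cb x ((2:ℝ) ^ (m + 1)))) :=
        (ENNReal.mul_div_cancel (volume_cb_ne_zero _ (by positivity))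
          (volume_cb_ne_top _ (by positivity))).symm
    _ ≤ _ := mul_le_mul' hv (le_iSup (fun k : ℤ => (∫⁻ y in cb x ((2:ℝ) ^ k), f y) /
        volume (cb x ((2:ℝ) ^ k))) (m + 1))

lemma Mx_pos {f : Euc n → ℝ≥0∞} (h : ∫⁻ y, f y ≠ 0) (x : Euc n) :
    Mx volume f x ≠ 0 := by
  intro h0
  apply h
  have h1 : ∀ k : ℕ, ∫⁻ y in cb x ((2:ℝ) ^ k), f y = 0 := by
    intro k
    have := le_iSup (fun k : ℤ => (∫⁻ y in cb x ((2:ℝ) ^ k), f y) / volume (cb x ((2:ℝ) ^ k))) k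
    have h2 := le_antisymm (this.trans h0.le) zero_le
    simp only [zpow_natCast] at h2
    rw [ENNReal.div_eq_zero_iff] at h2
    exact h2.resolve_right (volume_cb_ne_top _ (by positivity))
  have hU : (⋃ k : ℕ, cb x ((2:ℝ) ^ k)) = univ := by
    rw [eq_univ_iff_forall]
    intro y
    obtain ⟨k, hk⟩ := pow_unbounded_of_one_lt
      (dist (WithLp.ofLp y : Fin n → ℝ) (WithLp.ofLp x)) (one_lt_two (α := ℝ))
    exact mem_iUnion.2 ⟨k, hk.le⟩
  rw [← setLIntegral_univ, ← hU]
  refine le_antisymm ((lintegral_iUnion_le _ _).trans ?_) zero_le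
  simp [h1]

theorem rdf (n : ℕ) (p : ℝ) (hp : 1 < p) : ∃ C : ℝ≥0∞, C ≠ ⊤ ∧
    ∀ (w : Euc n → ℝ≥0∞), Measurable w → (∀ x, w x ≠ 0) → (∀ x, w x ≠ ⊤) →
    ∀ K : ℝ≥0∞, K ≠ ⊤ →
    (∀ x r, 0 < r → (∫⁻ y in cb x r, w y) * (∫⁻ y in cb x r, w y ^ (-1 / (p - 1))) ^ (p - 1)
      ≤ K * volume (cb x r) ^ p) →
    ∀ h : Euc n → ℝ≥0∞, Measurable h → ∫⁻ x, h x ^ p * w x ≠ ⊤ → ∫⁻ x, h x ^ p * w x ≠ 0 →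
    ∃ H : Euc n → ℝ≥0∞, Measurable H ∧ (∀ x, H x ≠ 0) ∧ (∀ x, H x ≠ ⊤) ∧
      (∀ᵐ x, h x ≤ H x) ∧ ∫⁻ x, H x ^ p * w x ≤ 2 ^ p * ∫⁻ x, h x ^ p * w x ∧
      ∀ z r, 0 < r → ∀ᵐ x ∂(volume.restrict (cb z r)),
        ∫⁻ y in cb z r, H y ≤ C * K ^ (1 / (p - 1)) * volume (cb z r) * H x := by
  have hp0 : 0 < p := by linarith
  have hp1 : 0 < p - 1 := by linarith
  obtain ⟨B, hB, hbuck⟩ := buckley n p hp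
  refine ⟨4 ^ n * 2 * (B + 1) ^ (1 / p), ?_, ?_⟩
  · refine ENNReal.mul_ne_top (by simp [ENNReal.mul_eq_top]) ?_
    exact ENNReal.rpow_ne_top_of_nonneg (by positivity) (by simp [hB])
  intro w hw h0 ht K hK hA h hh hfin hne
  have hK0 : K ≠ 0 := by
    intro hK0
    have := hA 0 1 one_pos
    rw [hK0, zero_mul, nonpos_iff_eq_zero, mul_eq_zero] at this
    have e1 := setLIntegral_cb_ne_zero hw h0 0 one_pos
    have e2 := setLIntegral_cb_ne_zero (hw.pow_const (-1 / (p - 1)))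
      (fun x => by simp [ENNReal.rpow_eq_zero_iff, h0, ht]) 0 one_pos
    rcases this with h' | h'
    · exact e1 h'
    · rw [ENNReal.rpow_eq_zero_iff] at h'
      rcases h' with h' | h'
      · exact e2 h'.1
      · linarith [h'.2]
  set D : ℝ≥0∞ := (B + 1) ^ (1 / p) * K ^ (1 / (p - 1)) with hD
  have hDt : D ≠ ⊤ := ENNReal.mul_ne_top
    (ENNReal.rpow_ne_top_of_nonneg (by positivity) (by simp [hB]))
    (ENNReal.rpow_ne_top_of_nonneg (by positivity) hK)
  have hD0 : D ≠ 0 := by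
    refine mul_ne_zero ?_ ?_
    · simp [ENNReal.rpow_eq_zero_iff, hB]
    · simp [ENNReal.rpow_eq_zero_iff, hK, hK0]
  have hDp : D ^ p = (B + 1) * K ^ (p / (p - 1)) := by
    rw [hD, ENNReal.mul_rpow_of_nonneg _ _ hp0.le, ← ENNReal.rpow_mul, ← ENNReal.rpow_mul]
    congr 1
    · rw [one_div_mul_cancel hp0.ne', ENNReal.rpow_one]
    · congr 1; ring
  set it : ℕ → Euc n → ℝ≥0∞ := fun k => (Mx volume)^[k] h with hit
  have hits : ∀ k, it (k + 1) = Mx volume (it k) := fun k => by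
    simp only [hit, Function.iterate_succ_apply']
  have hitm : ∀ k, Measurable (it k) := by
    intro k
    induction k with
    | zero => exact hh
    | succ k ih => rw [hits]; exact measurable_Mx _ ih
  have hitb : ∀ k, ∫⁻ x, (D⁻¹ ^ k * it k x) ^ p * w x ≤ ∫⁻ x, h x ^ p * w x := by
    intro k
    induction k with
    | zero => simp [hit]
    | succ k ih =>
      refine le_trans ?_ ih
      have e1 : ∀ k, ∫⁻ x, (D⁻¹ ^ k * it k x) ^ p * w x =
          (D⁻¹ ^ k) ^ p * ∫⁻ x, it k x ^ p * w x := by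
        intro k
        rw [← lintegral_const_mul _ (((hitm k).pow_const _).fun_mul hw)]
        refine lintegral_congr fun x => ?_
        rw [ENNReal.mul_rpow_of_nonneg _ _ hp0.le]
        simp [mul_assoc]
      rw [e1, e1, hits]
      have e2 := hbuck w hw h0 ht K hK hA (it k) (hitm k)
      have e3 : B * K ^ (p / (p - 1)) ≤ D ^ p := by rw [hDp]; gcongr; exact le_self_add
      have e4 : (D⁻¹) ^ p * D ^ p = 1 := by
        rw [← ENNReal.mul_rpow_of_nonneg _ _ hp0.le, ENNReal.inv_mul_cancel hD0 hDt, ENNReal.one_rpow]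
      calc (D⁻¹ ^ (k + 1)) ^ p * ∫⁻ x, Mx volume (it k) x ^ p * w x
          ≤ (D⁻¹ ^ (k + 1)) ^ p * (D ^ p * ∫⁻ x, it k x ^ p * w x) := by
            refine mul_le_mul_right (e2.trans (mul_le_mul_left e3 _)) _
        _ = (D⁻¹ ^ k) ^ p * ((D⁻¹) ^ p * D ^ p) * ∫⁻ x, it k x ^ p * w x := by
            rw [pow_succ, ENNReal.mul_rpow_of_nonneg _ _ hp0.le]; ring
        _ = _ := by rw [e4, mul_one]
  set H0 : Euc n → ℝ≥0∞ := fun x => ∑' k, ((2⁻¹:ℝ≥0∞) ^ k * D⁻¹ ^ k) * it k x with hH0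
  have hH0m : Measurable H0 := Measurable.tsum fun k => (hitm k).const_mul _
  have hH0n : ∫⁻ x, H0 x ^ p * w x ≤ 2 ^ p * ∫⁻ x, h x ^ p * w x := by
    calc ∫⁻ x, H0 x ^ p * w x
        ≤ ∫⁻ x, 2 ^ (p - 1) * ∑' k, (2⁻¹:ℝ≥0∞) ^ k * ((D⁻¹ ^ k * it k x) ^ p * w x) := by
          refine lintegral_mono fun x => ?_
          have := tsum_jensen hp.le (fun k => D⁻¹ ^ k * it k x)
          simp only [← mul_assoc] at this
          refine (mul_le_mul_left this _).trans (le_of_eq ?_)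
          rw [mul_assoc, ← ENNReal.tsum_mul_right]
          congr 1
          exact tsum_congr fun k => by ring
      _ = 2 ^ (p - 1) * ∑' k, (2⁻¹:ℝ≥0∞) ^ k * ∫⁻ x, (D⁻¹ ^ k * it k x) ^ p * w x := by
          have hm : ∀ k, Measurable fun x => (D⁻¹ ^ k * it k x) ^ p * w x := fun k =>
            (((hitm k).const_mul _).pow_const _).fun_mul hw
          rw [lintegral_const_mul _ (Measurable.tsum fun k => (hm k).const_mul _),
            lintegral_tsum fun k => ((hm k).const_mul _).aemeasurable]
          congr 1
          exact tsum_congr fun k => lintegral_const_mul _ (hm k)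
      _ ≤ 2 ^ (p - 1) * ∑' k : ℕ, (2⁻¹:ℝ≥0∞) ^ k * ∫⁻ x, h x ^ p * w x := by
          refine mul_le_mul_right (ENNReal.tsum_le_tsum fun k => mul_le_mul_right (hitb k) _) _
      _ = _ := by
          rw [ENNReal.tsum_mul_right, ENNReal.tsum_geometric, ENNReal.one_sub_inv_two, inv_inv,
            ← mul_assoc]
          congr 1
          nth_rw 2 [← ENNReal.rpow_one 2]
          rw [← ENNReal.rpow_add _ _ (by simp) (by simp)]; congr 1; ring
  have hM : ∀ x, Mx volume H0 x ≤ 2 * D * H0 x := by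
    intro x
    refine (Mx_tsum_le volume hitm _ x).trans ?_
    have h2D : (2 * D) * (2⁻¹ * D⁻¹) = 1 := by
      rw [mul_mul_mul_comm, ENNReal.mul_inv_cancel (by simp) (by simp),
        ENNReal.mul_inv_cancel hD0 hDt, one_mul]
    calc _ = ∑' k, 2 * D * (((2⁻¹:ℝ≥0∞) ^ (k+1) * D⁻¹ ^ (k+1)) * it (k+1) x) := by
          refine tsum_congr fun k => ?_
          rw [hits]
          calc _ = ((2 * D) * (2⁻¹ * D⁻¹)) * ((2⁻¹:ℝ≥0∞) ^ k * D⁻¹ ^ k * Mx volume (it k) x) := by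
                rw [h2D, one_mul]
            _ = _ := by ring
      _ = 2 * D * ∑' k, (((2⁻¹:ℝ≥0∞) ^ (k+1) * D⁻¹ ^ (k+1)) * it (k+1) x) :=
          ENNReal.tsum_mul_left
      _ ≤ 2 * D * H0 x := by
          refine mul_le_mul_right ?_ _
          exact ENNReal.tsum_comp_le_tsum_of_injective (Nat.succ_injective)
            (fun k => ((2⁻¹:ℝ≥0∞) ^ k * D⁻¹ ^ k) * it k x)
  have hhH : ∀ x, h x ≤ H0 x := by
    intro x
    have := ENNReal.le_tsum (f := fun k => ((2⁻¹:ℝ≥0∞) ^ k * D⁻¹ ^ k) * it k x) 0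
    simpa [hit] using this
  have hne_int : ∫⁻ y, h y ≠ 0 := by
    intro hz
    apply hne
    rw [lintegral_eq_zero_iff hh] at hz
    rw [lintegral_eq_zero_iff ((hh.pow_const _).fun_mul hw)]
    filter_upwards [hz] with x hx
    simp only [Pi.zero_apply] at hx
    simp [hx, hp0]
  have hH00 : ∀ x, H0 x ≠ 0 := by
    intro x hx
    have h1 := ENNReal.le_tsum (f := fun k => ((2⁻¹:ℝ≥0∞) ^ k * D⁻¹ ^ k) * it k x) 1
    have h2 : H0 x = ∑' k, ((2⁻¹:ℝ≥0∞) ^ k * D⁻¹ ^ k) * it k x := rfl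
    rw [← h2, hx, nonpos_iff_eq_zero, mul_eq_zero] at h1
    rcases h1 with h1 | h1
    · simp [hDt] at h1
    · exact Mx_pos hne_int x h1
  have hH0t : ∀ᵐ x, H0 x ≠ ⊤ := by
    have h1 : ∫⁻ x, H0 x ^ p * w x ≠ ⊤ := by
      refine ne_top_of_le_ne_top ?_ hH0n
      exact ENNReal.mul_ne_top (ENNReal.rpow_ne_top_of_nonneg (by positivity) (by simp)) hfin
    filter_upwards [ae_lt_top ((hH0m.pow_const _).fun_mul hw) h1] with x hx hxt
    simp only [hxt, ENNReal.top_rpow_of_pos hp0] at hx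
    rw [ENNReal.top_mul (h0 x)] at hx
    exact lt_irrefl _ hx
  set H : Euc n → ℝ≥0∞ := fun x => if H0 x = ⊤ then 1 else H0 x with hH
  have hHe : ∀ᵐ x, H x = H0 x := by
    filter_upwards [hH0t] with x hx
    simp [hH, hx]
  refine ⟨H, ?_, ?_, ?_, ?_, ?_, ?_⟩
  · exact Measurable.ite (hH0m (measurableSet_singleton _)) measurable_const hH0m
  · intro x; simp only [hH]; split_ifs
    · simp
    · exact hH00 x
  · intro x; simp only [hH]; split_ifs with hx
    · simp
    · exact hx
  · filter_upwards [hHe] with x hx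
    rw [hx]; exact hhH x
  · refine le_trans (le_of_eq (lintegral_congr_ae ?_)) hH0n
    filter_upwards [hHe] with x hx
    rw [hx]
  · intro z r hr
    have hHe' := ae_restrict_of_ae (s := cb z r) hHe
    rw [lintegral_congr_ae hHe']
    filter_upwards [hHe', ae_restrict_mem (measurableSet_cb z r)] with x hx hxz
    rw [hx]
    calc _ ≤ 4 ^ n * volume (cb z r) * Mx volume H0 x := uncentered H0 hr hxz
      _ ≤ 4 ^ n * volume (cb z r) * (2 * D * H0 x) := mul_le_mul_right (hM x) _
      _ = _ := by rw [hD]; ring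

/-- Muckenhoupt condition of order `s`, bounded by `K`. -/
def CC (s : ℝ) (W : Euc n → ℝ≥0∞) (K : ℝ≥0∞) : Prop :=
  ∀ z r, 0 < r → if s = 1 then ∀ᵐ x ∂(volume.restrict (cb z r)),
      ∫⁻ y in cb z r, W y ≤ K * volume (cb z r) * W x
    else (∫⁻ y in cb z r, W y) * (∫⁻ y in cb z r, W y ^ (-1 / (s - 1))) ^ (s - 1)
      ≤ K * volume (cb z r) ^ s

lemma rpow_ne_zero' {a : ℝ≥0∞} (h0 : a ≠ 0) (ht : a ≠ ⊤) (s : ℝ) : a ^ s ≠ 0 := by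
  simp [ENNReal.rpow_eq_zero_iff, h0, ht]

lemma rpow_ne_top' {a : ℝ≥0∞} (h0 : a ≠ 0) (ht : a ≠ ⊤) (s : ℝ) : a ^ s ≠ ⊤ := by
  simp [ENNReal.rpow_eq_top_iff, h0, ht]

lemma CC_ne_zero {s : ℝ} (hs : 1 < s) {W : Euc n → ℝ≥0∞} (hw : Measurable W)
    (h0 : ∀ x, W x ≠ 0) (ht : ∀ x, W x ≠ ⊤) {K : ℝ≥0∞} (hA : CC s W K) : K ≠ 0 := by
  intro hK0
  have := hA 0 1 one_pos
  rw [if_neg hs.ne', hK0, zero_mul, nonpos_iff_eq_zero, mul_eq_zero] at this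
  have e1 := setLIntegral_cb_ne_zero hw h0 0 one_pos
  have e2 := setLIntegral_cb_ne_zero (hw.pow_const (-1 / (s - 1)))
    (fun x => rpow_ne_zero' (h0 x) (ht x) _) 0 one_pos
  rcases this with h' | h'
  · exact e1 h'
  · rw [ENNReal.rpow_eq_zero_iff] at h'
    rcases h' with h' | h'
    · exact e2 h'.1
    · linarith [h'.2]

lemma A1_facts {H : Euc n → ℝ≥0∞} (hHm : Measurable H) (h0 : ∀ x, H x ≠ 0) (ht : ∀ x, H x ≠ ⊤)
    {L : ℝ≥0∞} (hL : L ≠ ⊤) {z : Euc n} {r : ℝ} (hr : 0 < r)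
    (hA : ∀ᵐ x ∂(volume.restrict (cb z r)), ∫⁻ y in cb z r, H y ≤ L * volume (cb z r) * H x) :
    (∫⁻ y in cb z r, H y) ≠ 0 ∧ (∫⁻ y in cb z r, H y) ≠ ⊤ ∧
    ∀ᵐ x ∂(volume.restrict (cb z r)),
      (H x)⁻¹ ≤ L * volume (cb z r) / (∫⁻ y in cb z r, H y) := by
  have e0 := setLIntegral_cb_ne_zero hHm h0 z hr
  have et : (∫⁻ y in cb z r, H y) ≠ ⊤ := by
    have : (ae (volume.restrict (cb z r))).NeBot := by
      rw [ae_neBot, Ne, Measure.restrict_eq_zero]; exact volume_cb_ne_zero z hr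
    obtain ⟨x, hx⟩ := hA.exists
    exact ne_top_of_le_ne_top (ENNReal.mul_ne_top
      (ENNReal.mul_ne_top hL (volume_cb_ne_top z hr.le)) (ht x)) hx
  refine ⟨e0, et, ?_⟩
  filter_upwards [hA] with x hx
  rw [ENNReal.le_div_iff_mul_le (Or.inl e0) (Or.inl et), mul_comm, ← div_eq_mul_inv,
    ENNReal.div_le_iff (h0 x) (ht x)]
  exact hx

lemma CC_A {s s₀ : ℝ} (hs : 1 < s) (hss : s < s₀) {W H : Euc n → ℝ≥0∞} (hWm : Measurable W)
    (hHm : Measurable H) (hW0 : ∀ x, W x ≠ 0) (hWt : ∀ x, W x ≠ ⊤)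
    (hH0 : ∀ x, H x ≠ 0) (hHt : ∀ x, H x ≠ ⊤) {K L : ℝ≥0∞} (hL : L ≠ ⊤)
    (hA : CC s W K) (hH : CC 1 H L) :
    CC s₀ (fun x => W x * H x ^ (-(s₀ - s))) (K * L ^ (s₀ - s)) := by
  intro z r hr
  rw [if_neg (by linarith)]
  have hA := hA z r hr
  have hH := hH z r hr
  rw [if_neg hs.ne'] at hA
  rw [if_pos rfl] at hH
  obtain ⟨e0, et, hinv⟩ := A1_facts hHm hH0 hHt hL hr hH
  set ρ := ∫⁻ y in cb z r, H y
  set V := volume (cb z r)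
  have hV0 : V ≠ 0 := volume_cb_ne_zero z hr
  have hVt : V ≠ ⊤ := volume_cb_ne_top z hr.le
  set ω := ∫⁻ y in cb z r, W y
  set σ := ∫⁻ y in cb z r, W y ^ (-1 / (s - 1))
  have hd : 0 < s₀ - s := by linarith
  have hs1 : 0 < s - 1 := by linarith
  have hs01 : 0 < s₀ - 1 := by linarith
  have h1 : ∫⁻ y in cb z r, W y * H y ^ (-(s₀ - s)) ≤ ω * (L * V / ρ) ^ (s₀ - s) := by
    rw [← lintegral_mul_const _ hWm]
    refine lintegral_mono_ae ?_
    filter_upwards [hinv] with x hx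
    rw [ENNReal.rpow_neg, ← ENNReal.inv_rpow]
    gcongr
  have h2 : ∫⁻ y in cb z r, (W y * H y ^ (-(s₀ - s))) ^ (-1 / (s₀ - 1)) ≤
      σ ^ ((s - 1) / (s₀ - 1)) * ρ ^ ((s₀ - s) / (s₀ - 1)) := by
    refine le_trans (le_of_eq ?_) (ENNReal.lintegral_mul_norm_pow_le
      (hWm.pow_const _).aemeasurable hHm.aemeasurable (by positivity) (by positivity)
      (by field_simp; ring))
    refine lintegral_congr fun x => ?_
    rw [ENNReal.mul_rpow_of_ne_top (hWt x) (rpow_ne_top' (hH0 x) (hHt x) _),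
      ← ENNReal.rpow_mul, ← ENNReal.rpow_mul]
    congr 2 <;> field_simp
  calc _ ≤ (ω * (L * V / ρ) ^ (s₀ - s)) *
        (σ ^ ((s - 1) / (s₀ - 1)) * ρ ^ ((s₀ - s) / (s₀ - 1))) ^ (s₀ - 1) := by gcongr
    _ = (ω * σ ^ (s - 1)) * ((L * V / ρ) * ρ) ^ (s₀ - s) := by
        rw [ENNReal.mul_rpow_of_nonneg _ _ hs01.le, ← ENNReal.rpow_mul, ← ENNReal.rpow_mul,
          div_mul_cancel₀ _ hs01.ne', div_mul_cancel₀ _ hs01.ne',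
          ENNReal.mul_rpow_of_nonneg _ _ hd.le]
        ring
    _ ≤ (K * V ^ s) * (L * V) ^ (s₀ - s) := by
        rw [ENNReal.div_mul_cancel e0 et]; gcongr
    _ = K * L ^ (s₀ - s) * (V ^ s * V ^ (s₀ - s)) := by
        rw [ENNReal.mul_rpow_of_nonneg _ _ hd.le]; ring
    _ = _ := by rw [← ENNReal.rpow_add _ _ hV0 hVt]; congr 2; ring

lemma CC_B {s s₀ : ℝ} (hs0 : 1 ≤ s₀) (hss : s₀ < s) {W R : Euc n → ℝ≥0∞} (hWm : Measurable W)
    (hRm : Measurable R) (hW0 : ∀ x, W x ≠ 0) (hWt : ∀ x, W x ≠ ⊤)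
    (hR0 : ∀ x, R x ≠ 0) (hRt : ∀ x, R x ≠ ⊤) {K L : ℝ≥0∞} (hL : L ≠ ⊤)
    (hA : CC s W K) (hR : CC 1 R L) {θ : ℝ} (hθ : θ = (s₀ - 1) / (s - 1)) :
    CC s₀ (fun x => W x ^ θ * R x ^ (1 - θ)) (K ^ θ * L ^ (1 - θ)) := by
  have hs1 : 0 < s - 1 := by linarith
  rcases hs0.eq_or_lt with h1 | h1
  · subst h1
    have : θ = 0 := by rw [hθ]; simp
    simpa [this] using hR
  intro z r hr
  rw [if_neg h1.ne']
  have hA := hA z r hr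
  have hR := hR z r hr
  rw [if_neg (by linarith)] at hA
  rw [if_pos rfl] at hR
  obtain ⟨e0, et, hinv⟩ := A1_facts hRm hR0 hRt hL hr hR
  set ρ := ∫⁻ y in cb z r, R y
  set V := volume (cb z r)
  have hV0 : V ≠ 0 := volume_cb_ne_zero z hr
  have hVt : V ≠ ⊤ := volume_cb_ne_top z hr.le
  set ω := ∫⁻ y in cb z r, W y
  set σ := ∫⁻ y in cb z r, W y ^ (-1 / (s - 1))
  have hs01 : 0 < s₀ - 1 := by linarith
  have hθ0 : 0 < θ := by rw [hθ]; positivity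
  have hθ1 : 0 < 1 - θ := by rw [hθ, sub_pos, div_lt_one hs1]; linarith
  have h1 : ∫⁻ y in cb z r, W y ^ θ * R y ^ (1 - θ) ≤ ω ^ θ * ρ ^ (1 - θ) :=
    ENNReal.lintegral_mul_norm_pow_le hWm.aemeasurable hRm.aemeasurable hθ0.le hθ1.le (by ring)
  have h2 : ∫⁻ y in cb z r, (W y ^ θ * R y ^ (1 - θ)) ^ (-1 / (s₀ - 1)) ≤
      σ * (L * V / ρ) ^ ((1 - θ) / (s₀ - 1)) := by
    rw [← lintegral_mul_const _ (hWm.pow_const _)]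
    refine lintegral_mono_ae ?_
    filter_upwards [hinv] with x hx
    rw [ENNReal.mul_rpow_of_ne_top (rpow_ne_top' (hW0 x) (hWt x) _)
      (rpow_ne_top' (hR0 x) (hRt x) _), ← ENNReal.rpow_mul, ← ENNReal.rpow_mul]
    have e1 : θ * (-1 / (s₀ - 1)) = -1 / (s - 1) := by rw [hθ]; field_simp
    have e2 : (1 - θ) * (-1 / (s₀ - 1)) = -((1 - θ) / (s₀ - 1)) := by ring
    rw [e1, e2, ENNReal.rpow_neg (R x), ← ENNReal.inv_rpow]
    gcongr
  calc _ ≤ (ω ^ θ * ρ ^ (1 - θ)) * (σ * (L * V / ρ) ^ ((1 - θ) / (s₀ - 1))) ^ (s₀ - 1) := by gcongr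
    _ = (ω * σ ^ (s - 1)) ^ θ * ((L * V / ρ) * ρ) ^ (1 - θ) := by
        rw [ENNReal.mul_rpow_of_nonneg _ _ hs01.le, ← ENNReal.rpow_mul,
          div_mul_cancel₀ _ hs01.ne', ENNReal.mul_rpow_of_nonneg _ _ hθ1.le,
          ENNReal.mul_rpow_of_nonneg _ _ hθ0.le, ← ENNReal.rpow_mul]
        have : (s - 1) * θ = s₀ - 1 := by rw [hθ]; field_simp
        rw [this]
        ring
    _ ≤ (K * V ^ s) ^ θ * (L * V) ^ (1 - θ) := by
        rw [ENNReal.div_mul_cancel e0 et]; gcongr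
    _ = K ^ θ * L ^ (1 - θ) * (V ^ (s * θ) * V ^ (1 - θ)) := by
        rw [ENNReal.mul_rpow_of_nonneg _ _ hθ1.le, ENNReal.mul_rpow_of_nonneg _ _ hθ0.le,
          ← ENNReal.rpow_mul]; ring
    _ = _ := by
        rw [← ENNReal.rpow_add _ _ hV0 hVt]; congr 2; rw [hθ]; field_simp; ring

/-- Exponential parametrization of positive finite extended reals. -/
def EE (t : ℝ) : ℝ≥0∞ := ENNReal.ofReal (Real.exp t)

lemma exists_EE {a : ℝ≥0∞} (h0 : a ≠ 0) (ht : a ≠ ⊤) : ∃ t, a = EE t := by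
  refine ⟨Real.log a.toReal, ?_⟩
  rw [EE, Real.exp_log (ENNReal.toReal_pos h0 ht), ENNReal.ofReal_toReal ht]

lemma EE_mul (a b : ℝ) : EE a * EE b = EE (a + b) := by
  rw [EE, EE, EE, Real.exp_add, ENNReal.ofReal_mul (Real.exp_nonneg a)]

lemma EE_rpow (a x : ℝ) : EE a ^ x = EE (a * x) := by
  rw [EE, EE, ENNReal.ofReal_rpow_of_pos (Real.exp_pos a), Real.exp_mul]

lemma EE_le {a b : ℝ} : EE a ≤ EE b ↔ a ≤ b := by
  rw [EE, EE, ENNReal.ofReal_le_ofReal_iff (Real.exp_nonneg b), Real.exp_le_exp]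

/-- The family of weighted inequalities at the starting exponents for a pair of functions. -/
def Hyp (p₀ q₀ s₀ γ : ℝ) (c₀ : ℝ≥0∞) (F G : Euc n → ℝ≥0∞) : Prop :=
  ∀ W₀ : Euc n → ℝ≥0∞, Measurable W₀ → (∀ x, W₀ x ≠ 0) → (∀ x, W₀ x ≠ ⊤) →
    ∀ K₀ : ℝ≥0∞, K₀ ≠ ⊤ → CC s₀ W₀ K₀ →
    (∫⁻ x, G x ^ q₀ * W₀ x) ^ (1 / q₀) ≤
      c₀ * K₀ ^ γ * (∫⁻ x, F x ^ p₀ * W₀ x ^ (p₀ / q₀)) ^ (1 / p₀)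

lemma CC_one (s : ℝ) : CC s (fun _ : Euc n => (1 : ℝ≥0∞)) 1 := by
  intro z r hr
  split_ifs with h
  · simp
  · simp only [ENNReal.one_rpow, lintegral_one, Measure.restrict_apply_univ, one_mul]
    apply le_of_eq
    nth_rewrite 1 [← ENNReal.rpow_one (volume (cb z r))]
    rw [← ENNReal.rpow_add _ _ (volume_cb_ne_zero z hr) (volume_cb_ne_top z hr.le)]
    congr 1; ring

lemma pwA1 {q q₀ s d : ℝ} (hq : 0 < q) (hq0 : 0 < q₀) (hd : d * q = s * (q₀ - q))
    {g w H : ℝ≥0∞} (hw0 : w ≠ 0) (hwt : w ≠ ⊤) (hH0 : H ≠ 0) (hHt : H ≠ ⊤) (hg : g ≠ ⊤) :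
    g ^ q * w = (g ^ q₀ * (w * H ^ (-d))) ^ (q / q₀) * (H ^ s * w) ^ (1 - q / q₀) := by
  rcases eq_or_ne g 0 with rfl | hg0
  · have : 0 < q / q₀ := by positivity
    simp [hq, hq0, this]
  obtain ⟨a, rfl⟩ := exists_EE hw0 hwt
  obtain ⟨b, rfl⟩ := exists_EE hH0 hHt
  obtain ⟨c, rfl⟩ := exists_EE hg0 hg
  simp only [EE_rpow, EE_mul]
  congr 1
  field_simp
  linear_combination b * hd

lemma pwA2 {p q p₀ q₀ s d : ℝ} (hp : 0 < p) (hp0 : 0 < p₀) (hq : 0 < q) (hq0 : 0 < q₀)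
    (hs : 0 < s)
    (hd : d * q = s * (q₀ - q)) (hd0 : 0 < d) (hexp : 1 / p - 1 / q = 1 / p₀ - 1 / q₀)
    {f w H : ℝ≥0∞} (hw0 : w ≠ 0) (hwt : w ≠ ⊤) (hH0 : H ≠ 0) (hHt : H ≠ ⊤) (hf : f ≠ ⊤)
    (hfH : (f ^ p * w ^ (p / q - 1)) ^ (1 / s) ≤ H) :
    f ^ p₀ * (w * H ^ (-d)) ^ (p₀ / q₀) ≤ f ^ p * w ^ (p / q) := by
  rcases eq_or_ne f 0 with rfl | hf0
  · simp [hp0]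
  obtain ⟨a, rfl⟩ := exists_EE hw0 hwt
  obtain ⟨b, rfl⟩ := exists_EE hH0 hHt
  obtain ⟨c, rfl⟩ := exists_EE hf0 hf
  simp only [EE_rpow, EE_mul, EE_le] at hfH ⊢
  have hd' : d = s * (q₀ - q) / q := by field_simp; linarith
  have h1 := mul_le_mul_of_nonneg_right hfH (show 0 ≤ d * p₀ / q₀ by positivity)
  have e1 : (1 / s) * (d * p₀ / q₀) = p₀ / p - 1 := by
    rw [hd']
    have : 1 / s * (s * (q₀ - q) / q * p₀ / q₀) = p₀ * (1 / q - 1 / q₀) := by field_simp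
    rw [this, show 1 / q - 1 / q₀ = 1 / p - 1 / p₀ by linarith]; field_simp
  have e2 : p₀ / q₀ = 1 + p₀ / q - p₀ / p := by
    have : p₀ / q₀ - 1 = p₀ * (1 / q₀ - 1 / p₀) := by field_simp
    rw [show 1 / q₀ - 1 / p₀ = 1 / q - 1 / p by linarith] at this
    linear_combination this
  have h2 : (c * p + a * (p / q - 1)) * (p₀ / p - 1) ≤ b * (d * p₀ / q₀) := by
    rw [← e1]; linarith
  have h3 : (a + b * -d) * (p₀ / q₀) = a * (1 + p₀ / q - p₀ / p) - b * (d * p₀ / q₀) := by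
    rw [← e2]; ring
  rw [h3]
  have h4 : (c * p + a * (p / q - 1)) * (p₀ / p - 1) =
    c * p₀ - c * p + a * (1 + p₀ / q - p₀ / p) - a * (p / q) := by field_simp; ring
  linarith

lemma coreA {p q p₀ q₀ s s₀ β γ : ℝ} (hp : 0 < p) (hp0 : 0 < p₀) (hq : 0 < q) (hqq : q < q₀)
    (hexp : 1 / p - 1 / q = 1 / p₀ - 1 / q₀) (hβ : 0 < β) (hγ : 0 < γ)
    (hsd : s = q * β) (hs0d : s₀ = q₀ * β) (hs : 1 < s) {c₀ : ℝ≥0∞} (hc₀ : c₀ ≠ ⊤) :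
    ∃ c : ℝ≥0∞, c ≠ ⊤ ∧ ∀ (W : Euc n → ℝ≥0∞), Measurable W → (∀ x, W x ≠ 0) → (∀ x, W x ≠ ⊤) →
      ∀ K : ℝ≥0∞, K ≠ ⊤ → CC s W K → ∀ F G : Euc n → ℝ≥0∞, Measurable F → Measurable G →
      (∀ x, F x ≠ ⊤) → (∀ x, G x ≠ ⊤) → Hyp p₀ q₀ s₀ γ c₀ F G →
      (∫⁻ x, G x ^ q * W x) ^ (1 / q) ≤
        c * K ^ (γ * ((s₀ - 1) / (s - 1))) * (∫⁻ x, F x ^ p * W x ^ (p / q)) ^ (1 / p) := by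
  obtain ⟨C, hC, hrdf⟩ := rdf n s hs
  have hq0 : 0 < q₀ := by linarith
  have hs' : 0 < s - 1 := by linarith
  have hss : s < s₀ := by rw [hsd, hs0d]; exact mul_lt_mul_of_pos_right hqq hβ
  set d := s₀ - s with hd
  have hd0 : 0 < d := by linarith
  have hdq : d * q = s * (q₀ - q) := by rw [hd, hsd, hs0d]; ring
  have hδ : 0 < 1 / q - 1 / q₀ := by
    have := one_div_lt_one_div_of_lt hq hqq
    linarith
  refine ⟨c₀ * C ^ (d * γ) * (2 ^ s) ^ (1 / q - 1 / q₀) + 1, ?_, ?_⟩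
  · refine ENNReal.add_ne_top.2 ⟨ENNReal.mul_ne_top (ENNReal.mul_ne_top hc₀ ?_) ?_, by simp⟩
    · exact ENNReal.rpow_ne_top_of_nonneg (by positivity) hC
    · exact ENNReal.rpow_ne_top_of_nonneg hδ.le
        (ENNReal.rpow_ne_top_of_nonneg (by linarith) (by simp))
  intro W hWm hW0 hWt K hK hA F G hFm hGm hFt hGt hyp
  have hK0 : K ≠ 0 := CC_ne_zero hs hWm hW0 hWt hA
  set J := ∫⁻ x, F x ^ p * W x ^ (p / q) with hJ
  rcases eq_or_ne J 0 with hJ0 | hJ0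
  · have h1 : ∀ᵐ x, F x = 0 := by
      rw [hJ, lintegral_eq_zero_iff (by fun_prop)] at hJ0
      filter_upwards [hJ0] with x hx
      have hx' : F x ^ p * W x ^ (p / q) = 0 := hx
      rcases mul_eq_zero.1 hx' with h' | h'
      · rcases ENNReal.rpow_eq_zero_iff.1 h' with h'' | h''
        · exact h''.1
        · linarith
      · exact absurd h' (rpow_ne_zero' (hW0 x) (hWt x) _)
    have h2 := hyp (fun _ => 1) measurable_const (by simp) (by simp) 1 (by simp) (CC_one s₀)
    have h3 : ∫⁻ x, F x ^ p₀ * (1 : ℝ≥0∞) ^ (p₀ / q₀) = 0 := by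
      rw [lintegral_eq_zero_iff (by fun_prop)]
      filter_upwards [h1] with x hx
      simp [hx, hp0]
    rw [h3, ENNReal.zero_rpow_of_pos (by positivity), mul_zero, nonpos_iff_eq_zero,
      ENNReal.rpow_eq_zero_iff] at h2
    have h4 : ∫⁻ x, G x ^ q₀ * 1 = 0 := by
      rcases h2 with h2 | h2
      · exact h2.1
      · have : 0 < 1 / q₀ := by positivity
        linarith [h2.2]
    rw [lintegral_eq_zero_iff (by fun_prop)] at h4
    have h5 : ∫⁻ x, G x ^ q * W x = 0 := by
      rw [lintegral_eq_zero_iff (by fun_prop)]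
      filter_upwards [h4] with x hx
      have hx' : G x ^ q₀ * 1 = 0 := hx
      rw [mul_one, ENNReal.rpow_eq_zero_iff] at hx'
      rcases hx' with h'' | h''
      · simp [h''.1, hq]
      · linarith
    rw [h5, ENNReal.zero_rpow_of_pos (by positivity)]
    exact bot_le
  rcases eq_or_ne J ⊤ with hJt | hJt
  · rw [hJt, ENNReal.top_rpow_of_pos (by positivity), ENNReal.mul_top]
    · exact le_top
    · exact mul_ne_zero (by simp) (rpow_ne_zero' hK0 hK _)
  set h : Euc n → ℝ≥0∞ := fun x => (F x ^ p * W x ^ (p / q - 1)) ^ (1 / s) with hh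
  have hhJ : ∫⁻ x, h x ^ s * W x = J := by
    rw [hJ]
    refine lintegral_congr fun x => ?_
    rw [hh]
    simp only
    rw [← ENNReal.rpow_mul, one_div_mul_cancel (by linarith), ENNReal.rpow_one, mul_assoc]
    congr 1
    nth_rewrite 2 [← ENNReal.rpow_one (W x)]
    rw [← ENNReal.rpow_add _ _ (hW0 x) (hWt x)]
    congr 1; ring
  obtain ⟨H, hHm, hH0, hHt, hhH, hHJ, hH1⟩ := hrdf W hWm hW0 hWt K hK
    (fun z r hr => by have := hA z r hr; rwa [if_neg hs.ne'] at this) h (by fun_prop)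
    (by rw [hhJ]; exact hJt) (by rw [hhJ]; exact hJ0)
  rw [hhJ] at hHJ
  set L := C * K ^ (1 / (s - 1)) with hL
  have hLt : L ≠ ⊤ := ENNReal.mul_ne_top hC (rpow_ne_top' hK0 hK _)
  have hCC := CC_A hs hss hWm hHm hW0 hWt hH0 hHt hLt hA
    (fun z r hr => by rw [if_pos rfl]; exact hH1 z r hr)
  have hKL : K * L ^ d = C ^ d * K ^ ((s₀ - 1) / (s - 1)) := by
    rw [hL, ENNReal.mul_rpow_of_nonneg _ _ hd0.le, mul_left_comm, ← ENNReal.rpow_mul]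
    congr 1
    nth_rewrite 1 [← ENNReal.rpow_one K]
    rw [← ENNReal.rpow_add _ _ hK0 hK]
    congr 1
    rw [hd]; field_simp; ring
  have hKt : K * L ^ d ≠ ⊤ :=
    ENNReal.mul_ne_top hK (ENNReal.rpow_ne_top_of_nonneg hd0.le hLt)
  have hmain := hyp (fun x => W x * H x ^ (-d)) (by fun_prop)
    (fun x => mul_ne_zero (hW0 x) (rpow_ne_zero' (hH0 x) (hHt x) _))
    (fun x => ENNReal.mul_ne_top (hWt x) (rpow_ne_top' (hH0 x) (hHt x) _)) _ hKt hCC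
  have hF : ∫⁻ x, F x ^ p₀ * (W x * H x ^ (-d)) ^ (p₀ / q₀) ≤ J := by
    rw [hJ]
    refine lintegral_mono_ae ?_
    filter_upwards [hhH] with x hx
    exact pwA2 hp hp0 hq hq0 (by linarith) hdq hd0 hexp (hW0 x) (hWt x) (hH0 x) (hHt x) (hFt x) hx
  have hG : ∫⁻ x, G x ^ q * W x ≤
      (∫⁻ x, G x ^ q₀ * (W x * H x ^ (-d))) ^ (q / q₀) * (2 ^ s * J) ^ (1 - q / q₀) := by
    have hqq1 : q / q₀ ≤ 1 := by rw [div_le_one hq0]; exact hqq.le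
    calc ∫⁻ x, G x ^ q * W x = ∫⁻ x, (G x ^ q₀ * (W x * H x ^ (-d))) ^ (q / q₀) *
          (H x ^ s * W x) ^ (1 - q / q₀) := by
          refine lintegral_congr fun x => ?_
          exact pwA1 hq hq0 hdq (hW0 x) (hWt x) (hH0 x) (hHt x) (hGt x)
      _ ≤ (∫⁻ x, G x ^ q₀ * (W x * H x ^ (-d))) ^ (q / q₀) *
          (∫⁻ x, H x ^ s * W x) ^ (1 - q / q₀) := by
          refine ENNReal.lintegral_mul_norm_pow_le ?_ ?_ (by positivity) (by linarith) (by ring)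
          · exact Measurable.aemeasurable (by fun_prop)
          · exact Measurable.aemeasurable (by fun_prop)
      _ ≤ _ := mul_le_mul_right (ENNReal.rpow_le_rpow hHJ (by linarith)) _
  calc (∫⁻ x, G x ^ q * W x) ^ (1 / q)
      ≤ ((∫⁻ x, G x ^ q₀ * (W x * H x ^ (-d))) ^ (q / q₀) * (2 ^ s * J) ^ (1 - q / q₀)) ^ (1 / q) :=
        ENNReal.rpow_le_rpow hG (by positivity)
    _ = (∫⁻ x, G x ^ q₀ * (W x * H x ^ (-d))) ^ (1 / q₀) * (2 ^ s * J) ^ (1 / q - 1 / q₀) := by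
        rw [ENNReal.mul_rpow_of_nonneg _ _ (by positivity), ← ENNReal.rpow_mul, ← ENNReal.rpow_mul]
        congr 2 <;> field_simp
    _ ≤ (c₀ * (K * L ^ d) ^ γ * J ^ (1 / p₀)) * (2 ^ s * J) ^ (1 / q - 1 / q₀) := by
        refine mul_le_mul_left (hmain.trans ?_) _
        exact mul_le_mul_right (ENNReal.rpow_le_rpow hF (by positivity)) _
    _ = (c₀ * C ^ (d * γ) * (2 ^ s) ^ (1 / q - 1 / q₀)) * K ^ (γ * ((s₀ - 1) / (s - 1))) *
        (J ^ (1 / p₀) * J ^ (1 / q - 1 / q₀)) := by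
        rw [hKL, ENNReal.mul_rpow_of_nonneg _ _ hγ.le, ENNReal.mul_rpow_of_nonneg _ _ hδ.le,
          ← ENNReal.rpow_mul C, ← ENNReal.rpow_mul K, mul_comm γ]
        ring
    _ ≤ _ := by
        rw [← ENNReal.rpow_add _ _ hJ0 hJt, show 1 / p₀ + (1 / q - 1 / q₀) = 1 / p by linarith]
        exact mul_le_mul_left (mul_le_mul_left le_self_add _) _

lemma lintegral_le_of_trunc {φ : Euc n → ℝ≥0∞} (hφ : Measurable φ) (ht : ∀ x, φ x ≠ ⊤) {B : ℝ≥0∞}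
    (h : ∀ S : Set (Euc n), MeasurableSet S → ∫⁻ x in S, φ x ≠ ⊤ → ∫⁻ x in S, φ x ≤ B) :
    ∫⁻ x, φ x ≤ B := by
  set S : ℕ → Set (Euc n) := fun N => spanningSets volume N ∩ {x | φ x ≤ N} with hS
  have hSm : ∀ N, MeasurableSet (S N) := fun N =>
    (measurableSet_spanningSets volume N).inter (hφ measurableSet_Iic)
  have hmono : Monotone S := by
    intro a b hab
    refine inter_subset_inter (monotone_spanningSets volume hab) ?_
    intro x hx
    have hx' : φ x ≤ a := hx
    exact hx'.trans (by exact_mod_cast hab)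
  have hU : ∀ x, ∃ N, x ∈ S N := by
    intro x
    obtain ⟨N, hN⟩ := ENNReal.exists_nat_gt (ht x)
    have : x ∈ ⋃ i, spanningSets (volume : Measure (Euc n)) i := by
      rw [iUnion_spanningSets]; trivial
    obtain ⟨M, hM⟩ := mem_iUnion.1 this
    refine ⟨max M N, monotone_spanningSets volume (le_max_left _ _) hM, ?_⟩
    show φ x ≤ _
    exact hN.le.trans (by exact_mod_cast le_max_right M N)
  have e : ∀ x, φ x = ⨆ N, (S N).indicator φ x := by
    intro x
    apply le_antisymm
    · obtain ⟨N, hN⟩ := hU x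
      refine le_iSup_of_le N ?_
      rw [indicator_of_mem hN]
    · exact iSup_le fun N => indicator_le_self _ _ _
  rw [lintegral_congr e, lintegral_iSup (fun N => hφ.indicator (hSm N))
    (fun a b hab x => indicator_le_indicator_of_subset (hmono hab) (fun _ => bot_le) x)]
  refine iSup_le fun N => ?_
  rw [lintegral_indicator (hSm N)]
  apply h _ (hSm N)
  have h1 : ∫⁻ x in S N, φ x ≤ ∫⁻ _ in S N, (N : ℝ≥0∞) :=
    setLIntegral_mono measurable_const (fun x hx => hx.2)
  refine ne_top_of_le_ne_top ?_ h1
  rw [setLIntegral_const]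
  exact ENNReal.mul_ne_top (by simp)
    (ne_top_of_le_ne_top (measure_spanningSets_lt_top volume N).ne (measure_mono inter_subset_left))

lemma pwB1 {q q₀ s s₀ β θ : ℝ} (hq : 0 < q) (hβ : 0 < β)
    (hsd : s = q * β) (hs0d : s₀ = q₀ * β) (hs : 1 < s) (hss : s₀ < s)
    (hθ : θ = (s₀ - 1) / (s - 1))
    {g w R : ℝ≥0∞} (hw0 : w ≠ 0) (hwt : w ≠ ⊤) (hR0 : R ≠ 0) (hRt : R ≠ ⊤) (hg : g ≠ ⊤)
    (hk : g ^ ((s - 1) / β) * w ≤ R) :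
    g ^ q * w ≤ g ^ q₀ * (w ^ θ * R ^ (1 - θ)) := by
  rcases eq_or_ne g 0 with rfl | hg0
  · simp [hq]
  obtain ⟨a, rfl⟩ := exists_EE hw0 hwt
  obtain ⟨b, rfl⟩ := exists_EE hR0 hRt
  obtain ⟨c, rfl⟩ := exists_EE hg0 hg
  simp only [EE_rpow, EE_mul, EE_le] at hk ⊢
  have hs1 : 0 < s - 1 := by linarith
  have h1 : 1 - θ = (s - s₀) / (s - 1) := by rw [hθ]; field_simp; ring
  have h2 : 0 ≤ 1 - θ := by rw [h1]; apply div_nonneg <;> linarith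
  have h3 := mul_le_mul_of_nonneg_right hk h2
  have h4 : (s - 1) / β * (1 - θ) = q - q₀ := by
    rw [h1, hsd, hs0d]
    rw [hsd] at hs1
    field_simp
  have h5 : (c * ((s - 1) / β) + a) * (1 - θ) = c * (q - q₀) + a * (1 - θ) := by
    rw [← h4]; ring
  nlinarith

lemma pwB2 {p q p₀ q₀ s s₀ β θ : ℝ} (hp : 0 < p) (hp0 : 0 < p₀) (hq : 0 < q) (hq0 : 0 < q₀)
    (hsd : s = q * β) (hs0d : s₀ = q₀ * β) (hs : 1 < s)
    (hexp : 1 / p - 1 / q = 1 / p₀ - 1 / q₀) (hθ : θ = (s₀ - 1) / (s - 1))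
    {f w R : ℝ≥0∞} (hw0 : w ≠ 0) (hwt : w ≠ ⊤) (hR0 : R ≠ 0) (hRt : R ≠ ⊤) (hf : f ≠ ⊤) :
    f ^ p₀ * (w ^ θ * R ^ (1 - θ)) ^ (p₀ / q₀) =
      (f ^ p * w ^ (p / q)) ^ (p₀ / p) *
        (R ^ (s / (s - 1)) * w ^ (-1 / (s - 1))) ^ (1 - p₀ / p) := by
  rcases eq_or_ne f 0 with rfl | hf0
  · have : 0 < p₀ / p := by positivity
    simp [hp, hp0, this]
  obtain ⟨a, rfl⟩ := exists_EE hw0 hwt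
  obtain ⟨b, rfl⟩ := exists_EE hR0 hRt
  obtain ⟨c, rfl⟩ := exists_EE hf0 hf
  simp only [EE_rpow, EE_mul]
  congr 1
  have hs1 : 0 < s - 1 := by linarith
  have hu : 1 - p₀ / p = p₀ * (1 / q₀ - 1 / q) := by
    rw [show 1 / q₀ - 1 / q = 1 / p₀ - 1 / p by linarith]; field_simp
  have e1 : (c * p + a * (p / q)) * (p₀ / p) = c * p₀ + a * (p₀ / q) := by field_simp
  rw [e1, hu, hθ, hs0d]
  rw [hsd] at hs1 ⊢
  have hne : q * β - 1 ≠ 0 := hs1.ne'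
  generalize hm : q * β - 1 = m at *
  have hβ' : β = (m + 1) / q := by field_simp; linarith
  rw [hβ']
  field_simp
  ring

lemma coreB {p q p₀ q₀ s s₀ β γ : ℝ} (hp : 0 < p) (hp0 : 0 < p₀) (hq0 : 0 < q₀) (hqq : q₀ < q)
    (hexp : 1 / p - 1 / q = 1 / p₀ - 1 / q₀) (hβ : 0 < β) (hγ : 0 < γ)
    (hsd : s = q * β) (hs0d : s₀ = q₀ * β) (hs0 : 1 ≤ s₀) {c₀ : ℝ≥0∞} (hc₀ : c₀ ≠ ⊤) :
    ∃ c : ℝ≥0∞, c ≠ ⊤ ∧ ∀ (W : Euc n → ℝ≥0∞), Measurable W → (∀ x, W x ≠ 0) → (∀ x, W x ≠ ⊤) →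
      ∀ K : ℝ≥0∞, K ≠ ⊤ → CC s W K → ∀ F G : Euc n → ℝ≥0∞, Measurable F → Measurable G →
      (∀ x, F x ≠ ⊤) → (∀ x, G x ≠ ⊤) → Hyp p₀ q₀ s₀ γ c₀ F G →
      (∫⁻ x, G x ^ q * W x) ^ (1 / q) ≤
        c * K ^ γ * (∫⁻ x, F x ^ p * W x ^ (p / q)) ^ (1 / p) := by
  have hq : 0 < q := by linarith
  have hss : s₀ < s := by rw [hsd, hs0d]; exact mul_lt_mul_of_pos_right hqq hβ
  have hs : 1 < s := by linarith
  have hs1 : 0 < s - 1 := by linarith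
  set t := s / (s - 1) with htd
  have ht : 1 < t := by rw [htd, lt_div_iff₀ hs1]; linarith
  have ht1 : t - 1 = 1 / (s - 1) := by rw [htd]; field_simp; ring
  obtain ⟨C, hC, hrdf⟩ := rdf n t ht
  set θ := (s₀ - 1) / (s - 1) with hθ
  have h1θ : 1 - θ = (s - s₀) / (s - 1) := by rw [hθ]; field_simp; ring
  have hθ0 : 0 ≤ θ := by rw [hθ]; apply div_nonneg <;> linarith
  have hθ1 : 0 < 1 - θ := by rw [h1θ]; apply div_pos <;> linarith
  have hδ : 0 < 1 / p₀ - 1 / p := by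
    have := one_div_lt_one_div_of_lt hq0 hqq
    linarith
  have hpp : 1 - p₀ / p = p₀ * (1 / p₀ - 1 / p) := by field_simp
  have hpp0 : 0 ≤ 1 - p₀ / p := by rw [hpp]; positivity
  refine ⟨c₀ * C ^ ((1 - θ) * γ) * (2 ^ t) ^ (1 / p₀ - 1 / p), ?_, ?_⟩
  · refine ENNReal.mul_ne_top (ENNReal.mul_ne_top hc₀ ?_) ?_
    · exact ENNReal.rpow_ne_top_of_nonneg (by positivity) hC
    · exact ENNReal.rpow_ne_top_of_nonneg hδ.le
        (ENNReal.rpow_ne_top_of_nonneg (by linarith) (by simp))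
  intro W hWm hW0 hWt K hK hA F G hFm hGm hFt hGt hyp
  have hK0 : K ≠ 0 := CC_ne_zero hs hWm hW0 hWt hA
  set I := ∫⁻ x, F x ^ p * W x ^ (p / q) with hI
  suffices hsuf : ∀ S : Set (Euc n), MeasurableSet S → ∫⁻ x in S, G x ^ q * W x ≠ ⊤ →
      (∫⁻ x in S, G x ^ q * W x) ^ (1 / q) ≤
        c₀ * C ^ ((1 - θ) * γ) * (2 ^ t) ^ (1 / p₀ - 1 / p) * K ^ γ * I ^ (1 / p) by
    rw [one_div q, ENNReal.rpow_inv_le_iff hq]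
    refine lintegral_le_of_trunc (by fun_prop) (fun x => ENNReal.mul_ne_top
      (ENNReal.rpow_ne_top_of_nonneg hq.le (hGt x)) (hWt x)) fun S hS hSt => ?_
    rw [← ENNReal.rpow_inv_le_iff hq, ← one_div]
    exact hsuf S hS hSt
  intro S hS hSt
  set g : Euc n → ℝ≥0∞ := S.indicator G with hg
  have hgm : Measurable g := hGm.indicator hS
  have hgG : ∀ x, g x ≤ G x := fun x => indicator_le_self _ _ _
  have hgt : ∀ x, g x ≠ ⊤ := fun x => ne_top_of_le_ne_top (hGt x) (hgG x)
  have hgJ : ∫⁻ x in S, G x ^ q * W x = ∫⁻ x, g x ^ q * W x := by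
    rw [← lintegral_indicator hS]
    refine lintegral_congr fun x => ?_
    by_cases hx : x ∈ S
    · simp [hg, hx]
    · simp [hg, hx, hq]
  rw [hgJ] at hSt ⊢
  set J := ∫⁻ x, g x ^ q * W x with hJ
  rcases eq_or_ne J 0 with hJ0 | hJ0
  · rw [hJ0, ENNReal.zero_rpow_of_pos (by positivity)]; exact bot_le
  set V : Euc n → ℝ≥0∞ := fun x => W x ^ (-1 / (s - 1)) with hV
  have hV0 : ∀ x, V x ≠ 0 := fun x => rpow_ne_zero' (hW0 x) (hWt x) _
  have hVt : ∀ x, V x ≠ ⊤ := fun x => rpow_ne_top' (hW0 x) (hWt x) _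
  have hVW : ∀ x, V x ^ (-1 / (t - 1)) = W x := by
    intro x
    simp only [hV]
    rw [← ENNReal.rpow_mul, ht1]
    have : -1 / (s - 1) * (-1 / (1 / (s - 1))) = 1 := by field_simp
    rw [this, ENNReal.rpow_one]
  set k : Euc n → ℝ≥0∞ := fun x => g x ^ ((s - 1) / β) * W x with hk
  have hkJ : ∫⁻ x, k x ^ t * V x = J := by
    refine lintegral_congr fun x => ?_
    simp only [hk, hV]
    rw [ENNReal.mul_rpow_of_nonneg _ _ (by linarith), ← ENNReal.rpow_mul, mul_assoc,
      ← ENNReal.rpow_add _ _ (hW0 x) (hWt x)]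
    have e1 : (s - 1) / β * t = q := by rw [htd, hsd]; rw [hsd] at hs1; field_simp
    have e2 : t + -1 / (s - 1) = 1 := by rw [htd]; field_simp; ring
    rw [e1, e2, ENNReal.rpow_one]
  obtain ⟨R, hRm, hR0, hRt, hkR, hRJ, hR1⟩ := hrdf V (by fun_prop) hV0 hVt (K ^ (1 / (s - 1)))
    (rpow_ne_top' hK0 hK _)
    (fun z r hr => by
      have := hA z r hr
      rw [if_neg hs.ne'] at this
      have h2 := ENNReal.rpow_le_rpow this (show 0 ≤ 1 / (s - 1) by positivity)
      rw [ENNReal.mul_rpow_of_nonneg _ _ (by positivity), ← ENNReal.rpow_mul,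
        mul_one_div_cancel hs1.ne', ENNReal.rpow_one, ENNReal.mul_rpow_of_nonneg _ _ (by positivity),
        ← ENNReal.rpow_mul, mul_one_div, ← htd, mul_comm] at h2
      simp only [hVW]
      rw [ht1]
      exact h2) k (by fun_prop)
    (by rw [hkJ]; exact hSt) (by rw [hkJ]; exact hJ0)
  rw [hkJ] at hRJ
  have hLK : C * (K ^ (1 / (s - 1))) ^ (1 / (t - 1)) = C * K := by
    rw [← ENNReal.rpow_mul, ht1]
    have : 1 / (s - 1) * (1 / (1 / (s - 1))) = 1 := by field_simp
    rw [this, ENNReal.rpow_one]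
  rw [hLK] at hR1
  have hLt : C * K ≠ ⊤ := ENNReal.mul_ne_top hC hK
  have hCC := CC_B hs0 hss hWm hRm hW0 hWt hR0 hRt hLt hA
    (fun z r hr => by rw [if_pos rfl]; exact hR1 z r hr) hθ
  have hKL : K ^ θ * (C * K) ^ (1 - θ) = C ^ (1 - θ) * K := by
    rw [ENNReal.mul_rpow_of_nonneg _ _ hθ1.le, mul_left_comm, ← ENNReal.rpow_add _ _ hK0 hK]
    simp
  rw [hKL] at hCC
  have hmain := hyp (fun x => W x ^ θ * R x ^ (1 - θ)) (by fun_prop)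
    (fun x => mul_ne_zero (rpow_ne_zero' (hW0 x) (hWt x) _) (rpow_ne_zero' (hR0 x) (hRt x) _))
    (fun x => ENNReal.mul_ne_top (rpow_ne_top' (hW0 x) (hWt x) _) (rpow_ne_top' (hR0 x) (hRt x) _))
    _ (ENNReal.mul_ne_top (ENNReal.rpow_ne_top_of_nonneg hθ1.le hC) hK) hCC
  have hG : J ≤ ∫⁻ x, G x ^ q₀ * (W x ^ θ * R x ^ (1 - θ)) := by
    refine lintegral_mono_ae ?_
    filter_upwards [hkR] with x hx
    refine (pwB1 hq hβ hsd hs0d hs hss hθ (hW0 x) (hWt x) (hR0 x) (hRt x) (hgt x) hx).trans ?_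
    exact mul_le_mul_left (ENNReal.rpow_le_rpow (hgG x) hq0.le) _
  have hF : ∫⁻ x, F x ^ p₀ * (W x ^ θ * R x ^ (1 - θ)) ^ (p₀ / q₀) ≤
      I ^ (p₀ / p) * (2 ^ t * J) ^ (1 - p₀ / p) := by
    calc _ = ∫⁻ x, (F x ^ p * W x ^ (p / q)) ^ (p₀ / p) * (R x ^ t * V x) ^ (1 - p₀ / p) := by
          refine lintegral_congr fun x => ?_
          exact pwB2 hp hp0 hq hq0 hsd hs0d hs hexp hθ (hW0 x) (hWt x) (hR0 x) (hRt x) (hFt x)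
      _ ≤ I ^ (p₀ / p) * (∫⁻ x, R x ^ t * V x) ^ (1 - p₀ / p) := by
          refine ENNReal.lintegral_mul_norm_pow_le ?_ ?_ (by positivity) hpp0 (by ring)
          · exact Measurable.aemeasurable (by fun_prop)
          · exact Measurable.aemeasurable (by fun_prop)
      _ ≤ _ := mul_le_mul_right (ENNReal.rpow_le_rpow hRJ hpp0) _
  have hJδ0 : J ^ (1 / p₀ - 1 / p) ≠ 0 := rpow_ne_zero' hJ0 hSt _
  have hJδt : J ^ (1 / p₀ - 1 / p) ≠ ⊤ := rpow_ne_top' hJ0 hSt _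
  have hfin : J ^ (1 / q) * J ^ (1 / p₀ - 1 / p) ≤
      (c₀ * C ^ ((1 - θ) * γ) * (2 ^ t) ^ (1 / p₀ - 1 / p) * K ^ γ * I ^ (1 / p)) *
        J ^ (1 / p₀ - 1 / p) := by
    calc J ^ (1 / q) * J ^ (1 / p₀ - 1 / p) = J ^ (1 / q₀) := by
          rw [← ENNReal.rpow_add _ _ hJ0 hSt]; congr 1; linarith
      _ ≤ _ := ENNReal.rpow_le_rpow hG (by positivity)
      _ ≤ _ := hmain
      _ ≤ c₀ * (C ^ (1 - θ) * K) ^ γ * (I ^ (p₀ / p) * (2 ^ t * J) ^ (1 - p₀ / p)) ^ (1 / p₀) :=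
          mul_le_mul_right (ENNReal.rpow_le_rpow hF (by positivity)) _
      _ = _ := by
          rw [ENNReal.mul_rpow_of_nonneg _ _ (show 0 ≤ 1 / p₀ by positivity), ← ENNReal.rpow_mul,
            ← ENNReal.rpow_mul, hpp,
            show p₀ / p * (1 / p₀) = 1 / p by field_simp,
            show p₀ * (1 / p₀ - 1 / p) * (1 / p₀) = 1 / p₀ - 1 / p by field_simp,
            ENNReal.mul_rpow_of_nonneg _ _ hδ.le, ENNReal.mul_rpow_of_nonneg _ _ hγ.le,
            ← ENNReal.rpow_mul C]
          ring
  exact (ENNReal.mul_le_mul_iff_left hJδ0 hJδt).1 hfin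

lemma core {p q p₀ q₀ s s₀ β γ : ℝ} (hp : 0 < p) (hp0 : 0 < p₀) (hq : 0 < q) (hq0 : 0 < q₀)
    (hexp : 1 / p - 1 / q = 1 / p₀ - 1 / q₀) (hβ : 0 < β) (hγ : 0 < γ)
    (hsd : s = q * β) (hs0d : s₀ = q₀ * β) (hs : 1 < s) (hs0 : 1 ≤ s₀)
    {c₀ : ℝ≥0∞} (hc₀ : c₀ ≠ ⊤) :
    ∃ c : ℝ≥0∞, c ≠ ⊤ ∧ ∀ (W : Euc n → ℝ≥0∞), Measurable W → (∀ x, W x ≠ 0) → (∀ x, W x ≠ ⊤) →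
      ∀ K : ℝ≥0∞, K ≠ ⊤ → CC s W K → ∀ F G : Euc n → ℝ≥0∞, Measurable F → Measurable G →
      (∀ x, F x ≠ ⊤) → (∀ x, G x ≠ ⊤) → Hyp p₀ q₀ s₀ γ c₀ F G →
      (∫⁻ x, G x ^ q * W x) ^ (1 / q) ≤
        c * K ^ (γ * max 1 ((s₀ - 1) / (s - 1))) *
          (∫⁻ x, F x ^ p * W x ^ (p / q)) ^ (1 / p) := by
  have hs1 : 0 < s - 1 := by linarith
  rcases lt_trichotomy q q₀ with h | h | h
  · have hm : max 1 ((s₀ - 1) / (s - 1)) = (s₀ - 1) / (s - 1) := by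
      apply max_eq_right
      rw [le_div_iff₀ hs1, hsd, hs0d]
      have := mul_le_mul_of_nonneg_right h.le hβ.le
      linarith
    rw [hm]
    exact coreA hp hp0 hq h hexp hβ hγ hsd hs0d hs hc₀
  · subst h
    have hss : s₀ = s := by rw [hsd, hs0d]
    have hpp : p = p₀ := by
      have : 1 / p = 1 / p₀ := by linarith
      simpa using this
    subst hpp
    rw [hss]
    refine ⟨c₀, hc₀, ?_⟩
    intro W hWm hW0 hWt K hK hA F G hFm hGm hFt hGt hyp
    have := hyp W hWm hW0 hWt K hK hA
    simpa [div_self hs1.ne'] using this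
  · have hm : max 1 ((s₀ - 1) / (s - 1)) = 1 := by
      apply max_eq_left
      rw [div_le_iff₀ hs1, hsd, hs0d]
      have := mul_le_mul_of_nonneg_right h.le hβ.le
      linarith
    rw [hm, mul_one]
    exact coreB hp hp0 hq0 h hexp hβ hγ hsd hs0d hs0 hc₀

lemma avg_iff {V A B K : ℝ≥0∞} {s : ℝ} (hs : 1 ≤ s) (hV0 : V ≠ 0) (hVt : V ≠ ⊤) :
    (V⁻¹ * A) * (V⁻¹ * B) ^ (s - 1) ≤ K ↔ A * B ^ (s - 1) ≤ K * V ^ s := by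
  have hs1 : 0 ≤ s - 1 := by linarith
  have e : (V⁻¹ * A) * (V⁻¹ * B) ^ (s - 1) = (A * B ^ (s - 1)) / V ^ s := by
    rw [ENNReal.mul_rpow_of_nonneg _ _ hs1, div_eq_mul_inv, ← ENNReal.inv_rpow,
      show s = 1 + (s - 1) by ring, ENNReal.rpow_add _ _ (by simp [hVt]) (by simp [hV0])]
    simp only [ENNReal.rpow_one, add_sub_cancel_left]
    ring
  rw [e, ENNReal.div_le_iff (rpow_ne_zero' hV0 hVt _) (rpow_ne_top' hV0 hVt _)]

lemma Apq_le_iff {p q s : ℝ} (hp : 1 < p) (hq : 0 < q) (hs : s - 1 = q / dualExp p)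
    (w : Euc n → ℝ) (K : ℝ≥0∞) :
    Apq p q w ≤ K ↔ CC s (fun x => ENNReal.ofReal (w x) ^ q) K := by
  have hp1 : 0 < p - 1 := by linarith
  have hd : 0 < dualExp p := by unfold dualExp; positivity
  have hs1 : 0 < s - 1 := by rw [hs]; positivity
  have e : ∀ x, (ENNReal.ofReal (w x) ^ q) ^ (-1 / (s - 1)) =
      ENNReal.ofReal (w x) ^ (-(dualExp p)) := by
    intro x
    rw [← ENNReal.rpow_mul, hs]
    congr 1
    field_simp
  unfold Apq CC
  simp only [iSup_le_iff, if_neg hp.ne', if_neg (show s ≠ 1 by linarith), e, ← hs]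
  constructor
  · intro h z r hr
    have := h (WithLp.toLp 2 (fun i => z i - r)) (2 * r) (by linarith)
    rw [← cb_eq_Cube z hr.le] at this
    exact (avg_iff (by linarith) (volume_cb_ne_zero z hr) (volume_cb_ne_top z hr.le)).1 this
  · intro h a r hr
    rw [Cube_eq_cb a hr.le]
    have hr2 : 0 < r / 2 := by linarith
    exact (avg_iff (by linarith) (volume_cb_ne_zero _ hr2) (volume_cb_ne_top _ hr2.le)).2
      (h _ _ hr2)

lemma Apq_one_le {q : ℝ} (hq : 0 < q) (w : Euc n → ℝ) (hwm : Measurable w) (hw : ∀ x, 0 < w x)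
    {K : ℝ≥0∞} (hK : K ≠ ⊤)
    (h : CC 1 (fun x => ENNReal.ofReal (w x) ^ q) K) : Apq 1 q w ≤ K := by
  unfold Apq
  simp only [iSup_le_iff, if_true]
  intro a r hr
  rw [Cube_eq_cb a hr.le]
  have hr2 : 0 < r / 2 := by linarith
  generalize (WithLp.toLp 2 (fun i => a i + r / 2) : Euc n) = z
  have h1 := h z (r / 2) hr2
  rw [if_pos rfl] at h1
  have w0 : ∀ x, ENNReal.ofReal (w x) ≠ 0 := fun x => by simp [hw x]
  obtain ⟨e0, et, hinv⟩ := A1_facts (H := fun x => ENNReal.ofReal (w x) ^ q) (by fun_prop)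
    (fun x => rpow_ne_zero' (w0 x) (by simp) _) (fun x => rpow_ne_top' (w0 x) (by simp) _) hK hr2 h1
  set A := ∫⁻ y in cb z (r / 2), ENNReal.ofReal (w y) ^ q
  have hv0 := volume_cb_ne_zero z hr2
  have hvt := volume_cb_ne_top z hr2.le
  set V := volume (cb z (r / 2))
  have h2 : essSup (fun x => (ENNReal.ofReal (w x))⁻¹) (volume.restrict (cb z (r / 2))) ≤
      (K * V / A) ^ (1 / q) := by
    refine essSup_le_of_ae_le _ ?_
    filter_upwards [hinv] with x hx
    rw [one_div, ENNReal.le_rpow_inv_iff hq, ENNReal.inv_rpow]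
    exact hx
  have h3 := ENNReal.rpow_le_rpow h2 hq.le
  rw [← ENNReal.rpow_mul, one_div_mul_cancel hq.ne', ENNReal.rpow_one] at h3
  refine (mul_le_mul_right h3 _).trans (le_of_eq ?_)
  rw [div_eq_mul_inv, show V⁻¹ * A * (K * V * A⁻¹) = K * (V⁻¹ * V) * (A * A⁻¹) by ring,
    ENNReal.inv_mul_cancel hv0 hvt, ENNReal.mul_inv_cancel e0 et, mul_one, mul_one]

lemma ae_of_cb {P : Euc n → Prop} (h : ∀ N : ℕ, ∀ᵐ x ∂(volume.restrict (cb (0 : Euc n) (N + 1))), P x) :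
    ∀ᵐ x, P x := by
  have hU : (⋃ N : ℕ, cb (0 : Euc n) (N + 1)) = univ := by
    rw [eq_univ_iff_forall]
    intro x
    obtain ⟨N, hN⟩ := exists_nat_ge (dist (WithLp.ofLp x) (WithLp.ofLp (0 : Euc n)))
    rw [mem_iUnion]
    refine ⟨N, ?_⟩
    show dist (WithLp.ofLp x) (WithLp.ofLp (0 : Euc n)) ≤ _
    linarith
  have := (ae_restrict_iUnion_iff (μ := (volume : Measure (Euc n)))
    (fun N : ℕ => cb (0 : Euc n) (N + 1)) P).2 h
  rwa [hU, Measure.restrict_univ] at this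

lemma dichotomy {s : ℝ} (hs : 1 < s) {W : Euc n → ℝ≥0∞} (hW : Measurable W) {K : ℝ≥0∞}
    (hK : K ≠ ⊤) (h : CC s W K) : (∀ᵐ x, W x = 0) ∨ (∀ᵐ x, W x ≠ 0) := by
  by_cases hN : ∃ N : ℕ, ∫⁻ y in cb (0 : Euc n) (N + 1), W y ≠ 0
  · right
    obtain ⟨N, hN⟩ := hN
    apply ae_of_cb
    intro M
    have hr : (0 : ℝ) < (max M N : ℕ) + 1 := by positivity
    have hsub : ∀ k : ℕ, k ≤ max M N →
        cb (0 : Euc n) (k + 1) ⊆ cb (0 : Euc n) ((max M N : ℕ) + 1) := by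
      intro k hk x hx
      have hx' : dist (WithLp.ofLp x) (WithLp.ofLp (0 : Euc n)) ≤ k + 1 := hx
      show dist (WithLp.ofLp x) (WithLp.ofLp (0 : Euc n)) ≤ _
      have : (k : ℝ) ≤ (max M N : ℕ) := by exact_mod_cast hk
      linarith
    have h1 := h 0 _ hr
    rw [if_neg hs.ne'] at h1
    have hA : ∫⁻ y in cb (0 : Euc n) ((max M N : ℕ) + 1), W y ≠ 0 := by
      intro h0
      apply hN
      rw [← nonpos_iff_eq_zero, ← h0]
      exact lintegral_mono_set (hsub N (le_max_right _ _))
    have hB : ∫⁻ y in cb (0 : Euc n) ((max M N : ℕ) + 1), W y ^ (-1 / (s - 1)) ≠ ⊤ := by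
      intro ht
      rw [ht, ENNReal.top_rpow_of_pos (by linarith), ENNReal.mul_top hA, top_le_iff] at h1
      exact ENNReal.mul_ne_top hK (ENNReal.rpow_ne_top_of_nonneg (by linarith)
        (volume_cb_ne_top _ hr.le)) h1
    have h2 := ae_lt_top (hW.pow_const (-1 / (s - 1))) hB
    refine ae_restrict_of_ae_restrict_of_subset (hsub M (le_max_left _ _)) ?_
    filter_upwards [h2] with x hx h0
    rw [h0, ENNReal.zero_rpow_of_neg (by
      rw [neg_div]; have : 0 < 1 / (s - 1) := by apply one_div_pos.2; linarith
      linarith)] at hx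
    exact lt_irrefl _ hx
  · left
    push Not at hN
    apply ae_of_cb
    intro N
    exact (lintegral_eq_zero_iff hW).1 (hN N)

lemma CC_congr {s : ℝ} {W W' : Euc n → ℝ≥0∞} (hW : ∀ᵐ x, W x = W' x) {K : ℝ≥0∞}
    (h : CC s W K) : CC s W' K := by
  intro z r hr
  have h1 := h z r hr
  have hr' : ∀ᵐ x ∂(volume.restrict (cb z r)), W x = W' x := ae_restrict_of_ae hW
  have e1 : ∫⁻ y in cb z r, W y = ∫⁻ y in cb z r, W' y := lintegral_congr_ae hr'
  have e2 : ∀ t : ℝ, ∫⁻ y in cb z r, W y ^ t = ∫⁻ y in cb z r, W' y ^ t := fun t =>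
    lintegral_congr_ae (by filter_upwards [hr'] with x hx; rw [hx])
  split_ifs with hs
  · rw [if_pos hs] at h1
    rw [← e1]
    filter_upwards [h1, hr'] with x hx hx'
    rwa [← hx']
  · rw [if_neg hs] at h1
    rwa [← e1, ← e2]

/-- Off-diagonal extrapolation with sharp constants (Theorem 2.1). -/
theorem extrapolation_offdiagonal_sharp
    (n : ℕ) (hn : 0 < n) (p₀ q₀ γ c₀ : ℝ)
    (hp₀ : 1 ≤ p₀) (hp₀q₀ : p₀ ≤ q₀) (hγ : 0 < γ)
    (T : (Euc n → ℝ) → (Euc n → ℝ))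
    (hT : ∀ w f : Euc n → ℝ, Measurable w → (∀ x, 0 ≤ w x) → Measurable f →
      Apq p₀ q₀ w < ⊤ →
      wLp w (T f) q₀ ≤ ENNReal.ofReal c₀ * Apq p₀ q₀ w ^ γ * wLp w f p₀)
    (p q : ℝ) (hp : 1 < p) (hpq : p ≤ q)
    (hexp : 1 / p - 1 / q = 1 / p₀ - 1 / q₀) :
    ∃ c : ℝ, 0 < c ∧ ∀ w f : Euc n → ℝ, Measurable w → (∀ x, 0 ≤ w x) → Measurable f →
      Apq p q w < ⊤ →
      wLp w (T f) q ≤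
        ENNReal.ofReal c * Apq p q w ^ (γ * max 1 (q₀ / dualExp p₀ * (dualExp p / q))) *
          wLp w f p := by
  have hq : 0 < q := by linarith
  have hq0 : 0 < q₀ := by linarith
  have hp' : 0 < p := by linarith
  have hp0' : 0 < p₀ := by linarith
  have hp1 : 0 < p - 1 := by linarith
  obtain ⟨β, hβd⟩ : ∃ β, β = 1 - 1 / p + 1 / q := ⟨_, rfl⟩
  have hβd0 : β = 1 - 1 / p₀ + 1 / q₀ := by rw [hβd]; linarith
  obtain ⟨s, hsd⟩ : ∃ s, s = q * β := ⟨_, rfl⟩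
  obtain ⟨s₀, hs0d⟩ : ∃ s₀, s₀ = q₀ * β := ⟨_, rfl⟩
  have hβ : 0 < β := by
    have h1 : 1 / p < 1 := by rw [div_lt_one hp']; exact hp
    have h2 : 0 < 1 / q := by positivity
    linarith
  have hse : s - 1 = q / dualExp p := by
    rw [hsd, hβd, dualExp]; field_simp; ring
  have hs0e : s₀ - 1 = q₀ / dualExp p₀ := by
    rw [hs0d, hβd0, dualExp]
    rcases hp₀.eq_or_lt with h | h
    · subst h; simp [hq0.ne']
    · have : 0 < p₀ - 1 := by linarith
      field_simp; ring
  have hdp : 0 < dualExp p := by unfold dualExp; positivity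
  have hs : 1 < s := by
    have : 0 < q / dualExp p := by positivity
    linarith
  have hs0 : 1 ≤ s₀ := by
    have : 0 ≤ q₀ / dualExp p₀ := by
      unfold dualExp
      have : 0 ≤ p₀ - 1 := by linarith
      positivity
    linarith
  have hratio : q₀ / dualExp p₀ * (dualExp p / q) = (s₀ - 1) / (s - 1) := by
    rw [hs0e, hse, div_eq_mul_inv (q₀ / dualExp p₀) (q / dualExp p), inv_div]
  rw [hratio]
  obtain ⟨c, hc, hcore⟩ := core (n := n) hp' hp0' hq hq0 hexp hβ hγ hsd hs0d hs hs0
    (ENNReal.ofReal_ne_top (r := c₀))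
  refine ⟨c.toReal + 1, by positivity, ?_⟩
  have hcc : c ≤ ENNReal.ofReal (c.toReal + 1) := by
    rw [ENNReal.ofReal_add (by positivity) (by positivity), ENNReal.ofReal_toReal hc]
    exact le_self_add
  intro w f hwm hw hfm hA
  have hCC : CC s (fun x => ENNReal.ofReal (w x) ^ q) (Apq p q w) :=
    (Apq_le_iff hp hq hse w _).1 le_rfl
  set K := Apq p q w
  rcases dichotomy hs (by fun_prop) hA.ne hCC with hz | hnz
  · have : wLp w (T f) q = 0 := by
      unfold wLp
      have h0 : ∫⁻ x, (ENNReal.ofReal (w x) * ENNReal.ofReal |T f x|) ^ q = 0 := by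
        rw [← lintegral_zero (μ := (volume : Measure (Euc n)))]
        refine lintegral_congr_ae ?_
        filter_upwards [hz] with x hx
        rw [ENNReal.mul_rpow_of_nonneg _ _ hq.le, hx, zero_mul]
      rw [h0, ENNReal.zero_rpow_of_pos (by positivity)]
    rw [this]; exact bot_le
  set w' : Euc n → ℝ := fun x => if w x = 0 then 1 else w x with hw'
  have hw'm : Measurable w' :=
    Measurable.ite (hwm (measurableSet_singleton 0)) measurable_const hwm
  have hw'pos : ∀ x, 0 < w' x := by
    intro x
    simp only [hw']
    split_ifs with h
    · exact one_pos
    · exact lt_of_le_of_ne (hw x) (Ne.symm h)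
  have hww : ∀ᵐ x, w x = w' x := by
    filter_upwards [hnz] with x hx
    have : w x ≠ 0 := by
      intro h0
      apply hx
      simp [h0, hq]
    simp [hw', this]
  have hCC' : CC s (fun x => ENNReal.ofReal (w' x) ^ q) K :=
    CC_congr (by filter_upwards [hww] with x hx; rw [hx]) hCC
  have hL : ∀ (g : Euc n → ℝ) (t : ℝ), wLp w g t = wLp w' g t := by
    intro g t
    unfold wLp
    congr 1
    refine lintegral_congr_ae ?_
    filter_upwards [hww] with x hx
    rw [hx]
  rw [hL, hL]
  have w0 : ∀ x, ENNReal.ofReal (w' x) ≠ 0 := fun x => by simp [hw'pos x]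
  obtain ⟨h, hhm, hhle, hheq⟩ := exists_measurable_le_lintegral_eq volume
    (fun x => (ENNReal.ofReal (w' x) * ENNReal.ofReal |T f x|) ^ q)
  set G : Euc n → ℝ≥0∞ := fun x => h x ^ (1 / q) * (ENNReal.ofReal (w' x))⁻¹ with hG
  have hGm : Measurable G := by fun_prop
  have hGle : ∀ x, G x ≤ ENNReal.ofReal |T f x| := by
    intro x
    have h1 : h x ^ (1 / q) ≤ ENNReal.ofReal (w' x) * ENNReal.ofReal |T f x| := by
      rw [one_div, ENNReal.rpow_inv_le_iff hq]; exact hhle x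
    simp only [hG]
    rw [← div_eq_mul_inv]
    refine ENNReal.div_le_of_le_mul ?_
    rwa [mul_comm] at h1
  have hGt : ∀ x, G x ≠ ⊤ := fun x => ne_top_of_le_ne_top ENNReal.ofReal_ne_top (hGle x)
  have hGq : ∀ x, G x ^ q * ENNReal.ofReal (w' x) ^ q = h x := by
    intro x
    simp only [hG]
    rw [← ENNReal.mul_rpow_of_nonneg _ _ hq.le, mul_assoc,
      ENNReal.inv_mul_cancel (w0 x) ENNReal.ofReal_ne_top, mul_one, ← ENNReal.rpow_mul,
      one_div_mul_cancel hq.ne', ENNReal.rpow_one]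
  have hyp : Hyp p₀ q₀ s₀ γ (ENNReal.ofReal c₀) (fun x => ENNReal.ofReal |f x|) G := by
    intro W₀ hWm hW0 hWt K₀ hK₀ hC₀
    set v : Euc n → ℝ := fun x => (W₀ x ^ (1 / q₀)).toReal with hv
    have hvm : Measurable v := by fun_prop
    have hvo : ∀ x, ENNReal.ofReal (v x) = W₀ x ^ (1 / q₀) := fun x =>
      ENNReal.ofReal_toReal (rpow_ne_top' (hW0 x) (hWt x) _)
    have hvq : ∀ x, ENNReal.ofReal (v x) ^ q₀ = W₀ x := fun x => by
      rw [hvo, ← ENNReal.rpow_mul, one_div_mul_cancel hq0.ne', ENNReal.rpow_one]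
    have hvpos : ∀ x, 0 < v x := fun x =>
      ENNReal.toReal_pos (rpow_ne_zero' (hW0 x) (hWt x) _) (rpow_ne_top' (hW0 x) (hWt x) _)
    have hC' : CC s₀ (fun x => ENNReal.ofReal (v x) ^ q₀) K₀ := by
      simp only [hvq]; exact hC₀
    have hle : Apq p₀ q₀ v ≤ K₀ := by
      rcases hp₀.eq_or_lt with h1 | h1
      · subst h1
        have : s₀ = 1 := by
          have := hs0e
          simp [dualExp] at this
          linarith
        rw [this] at hC'
        exact Apq_one_le hq0 v hvm hvpos hK₀ hC'
      · exact (Apq_le_iff h1 hq0 hs0e v K₀).2 hC'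
    have hmain := hT v f hvm (fun x => (hvpos x).le) hfm (lt_of_le_of_lt hle hK₀.lt_top)
    calc (∫⁻ x, G x ^ q₀ * W₀ x) ^ (1 / q₀) ≤ wLp v (T f) q₀ := by
          unfold wLp
          refine ENNReal.rpow_le_rpow (lintegral_mono fun x => ?_) (by positivity)
          show G x ^ q₀ * W₀ x ≤ _
          rw [ENNReal.mul_rpow_of_nonneg (ENNReal.ofReal (v x)) _ hq0.le, hvq, mul_comm]
          exact mul_le_mul_right (ENNReal.rpow_le_rpow (hGle x) hq0.le) _
      _ ≤ _ := hmain
      _ ≤ ENNReal.ofReal c₀ * K₀ ^ γ * wLp v f p₀ :=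
          mul_le_mul_left (mul_le_mul_right (ENNReal.rpow_le_rpow hle hγ.le) _) _
      _ = _ := by
          congr 1
          unfold wLp
          congr 1
          refine lintegral_congr fun x => ?_
          rw [ENNReal.mul_rpow_of_nonneg _ _ hp0'.le, hvo, ← ENNReal.rpow_mul, mul_comm,
            one_div_mul_eq_div]
  have hfin := hcore (fun x => ENNReal.ofReal (w' x) ^ q) (by fun_prop)
    (fun x => rpow_ne_zero' (w0 x) (by simp) _) (fun x => rpow_ne_top' (w0 x) (by simp) _)
    K hA.ne hCC' (fun x => ENNReal.ofReal |f x|) G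
    (ENNReal.measurable_ofReal.comp (continuous_abs.measurable.comp hfm)) hGm
    (by simp) hGt hyp
  simp only [hGq] at hfin
  calc wLp w' (T f) q = (∫⁻ x, h x) ^ (1 / q) := by
        unfold wLp; rw [hheq]
    _ ≤ _ := hfin
    _ = c * K ^ (γ * max 1 ((s₀ - 1) / (s - 1))) * wLp w' f p := by
        congr 1
        unfold wLp
        congr 1
        refine lintegral_congr fun x => ?_
        rw [ENNReal.mul_rpow_of_nonneg _ _ hp'.le, ← ENNReal.rpow_mul, mul_comm,
          mul_div_cancel₀ _ hq.ne']
    _ ≤ _ := mul_le_mul_left (mul_le_mul_left hcc _) _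

end
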